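/- arXiv:2007.12518 — 2 statements merged into one kernel-verified Lean document; each statement's English description precedes it below -/
import Mathlib

section
/- Every element g of Ŝ can be written in standard form: there exist n ≥ 0, an element f of Thompson's group T, integers t_1, …, t_n, and finite binary sequences s_1, …, s_n with s_i < s_j whenever i < j, such that g = f · y_{s_1}^{t_1} ⋯ y_{s_n}^{t_n}. -/
/-- The Cantor set of infinite binary sequences. -/
abbrev Cantor : Type := ℕ → Bool

/-- Concatenation of a finite binary sequence with an infinite binary sequence. -/
def cat (s : List Bool) (η : Cantor) : Cantor :=
  fun n => if h : n < s.length then s.get ⟨n, h⟩ else η (n - s.length)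

/-- `s` is a (finite) prefix of the infinite sequence `ξ`. -/
def IsPrefixOf (s : List Bool) (ξ : Cantor) : Prop := ∃ η : Cantor, ξ = cat s η

/-- The group of self-homeomorphisms of a topological space, with
`(f * g) ξ = f (g ξ)` (i.e. in the right-action convention `ξ·(g h) = (ξ·g)·h`,
the product `g * f` corresponds to the word "apply `f`, then `g`"). -/
instance {α : Type*} [TopologicalSpace α] : Group (α ≃ₜ α) where
  mul f g := g.trans f
  one := Homeomorph.refl α
  inv := Homeomorph.symm
  mul_assoc _ _ _ := Homeomorph.ext fun _ => rfl
  one_mul _ := Homeomorph.ext fun _ => rfl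
  mul_one _ := Homeomorph.ext fun _ => rfl
  inv_mul_cancel f := Homeomorph.ext fun ξ => f.symm_apply_apply ξ

@[simp] lemma homeo_mul_apply {α : Type*} [TopologicalSpace α] (f g : α ≃ₜ α) (ξ : α) :
    (f * g) ξ = f (g ξ) := rfl

@[simp] lemma homeo_one_apply {α : Type*} [TopologicalSpace α] (ξ : α) :
    (1 : α ≃ₜ α) ξ = ξ := rfl

@[simp] lemma homeo_inv_apply {α : Type*} [TopologicalSpace α] (f : α ≃ₜ α) (ξ : α) :
    (f⁻¹ : α ≃ₜ α) ξ = f.symm ξ := rfl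

/-- The data of the basic homeomorphisms `x`, `y`, `x_s`, `y_s`, `p_n` of the Cantor
set, together with their recursive defining equations. -/
structure LMData where
  x : Cantor ≃ₜ Cantor
  y : Cantor ≃ₜ Cantor
  xx : List Bool → Cantor ≃ₜ Cantor
  yy : List Bool → Cantor ≃ₜ Cantor
  p : ℕ → Cantor ≃ₜ Cantor
  hx00 : ∀ η, x (cat [false, false] η) = cat [false] η
  hx01 : ∀ η, x (cat [false, true] η) = cat [true, false] η
  hx1 : ∀ η, x (cat [true] η) = cat [true, true] η
  hy00 : ∀ η, y (cat [false, false] η) = cat [false] (y η)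
  hy01 : ∀ η, y (cat [false, true] η) = cat [true, false] (y.symm η)
  hy1 : ∀ η, y (cat [true] η) = cat [true, true] (y η)
  hxx : ∀ s η, xx s (cat s η) = cat s (x η)
  hxx' : ∀ s ξ, ¬ IsPrefixOf s ξ → xx s ξ = ξ
  hyy : ∀ s η, yy s (cat s η) = cat s (y η)
  hyy' : ∀ s ξ, ¬ IsPrefixOf s ξ → yy s ξ = ξ
  hp1 : ∀ n k η, k < n → p n (cat (List.replicate k true ++ [false]) η) =
      cat (List.replicate (k + 1) true ++ [false]) η
  hp2 : ∀ n η, p n (cat (List.replicate n true ++ [false]) η) =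
      cat (List.replicate (n + 1) true) η
  hp3 : ∀ n η, p n (cat (List.replicate (n + 1) true) η) = cat [false] η

/-- Thompson's group `T`, generated by all `x_s` and all `p_n`. -/
def Tgrp (D : LMData) : Subgroup (Cantor ≃ₜ Cantor) :=
  Subgroup.closure (Set.range D.xx ∪ Set.range D.p)

/-- The group `Ŝ`, generated by all `x_s`, all `y_s` and all `p_n`. -/
def Shat (D : LMData) : Subgroup (Cantor ≃ₜ Cantor) :=
  Subgroup.closure (Set.range D.xx ∪ Set.range D.yy ∪ Set.range D.p)

/-- The homeomorphism `y₁₀ y₁₁₀⁻¹` (right-action word: first `y₁₀`, then `y₁₁₀⁻¹`). -/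
def sgen (D : LMData) : Cantor ≃ₜ Cantor :=
  (D.yy [true, true, false])⁻¹ * D.yy [true, false]

/-- The group `S`, generated by Thompson's group `T` together with `y₁₀ y₁₁₀⁻¹`. -/
def Sgrp (D : LMData) : Subgroup (Cantor ≃ₜ Cantor) :=
  Subgroup.closure (↑(Tgrp D) ∪ {sgen D})

/-- The Lodha–Moore group `_yG_y`, generated by all `x_s` and all `y_s`. -/
def LMgrp (D : LMData) : Subgroup (Cantor ≃ₜ Cantor) :=
  Subgroup.closure (Set.range D.xx ∪ Set.range D.yy)

/-- The strict partial order `<` on finite binary sequences. -/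
def seqLT (s t : List Bool) : Prop :=
  (∃ u : List Bool, u ≠ [] ∧ s = t ++ u) ∨
  ∃ u v w : List Bool, s = u ++ false :: v ∧ t = u ++ true :: w

namespace LodhaMoore

/-! ### Finite prefixes and cones -/

lemma cat_nil (η : Cantor) : cat [] η = η := by
  funext n
  simp [cat]

lemma cat_cons_zero (b : Bool) (s : List Bool) (η : Cantor) : cat (b :: s) η 0 = b := by
  simp [cat]

lemma cat_cons_succ (b : Bool) (s : List Bool) (η : Cantor) (n : ℕ) :
    cat (b :: s) η (n + 1) = cat s η n := by
  simp [cat]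

lemma cat_cons_inj {a b : Bool} {s t : List Bool} {η ζ : Cantor} :
    cat (a :: s) η = cat (b :: t) ζ ↔ a = b ∧ cat s η = cat t ζ := by
  constructor
  · intro h
    refine ⟨by simpa [cat_cons_zero] using congrFun h 0, funext fun n => ?_⟩
    simpa [cat_cons_succ] using congrFun h (n + 1)
  · rintro ⟨rfl, h⟩
    funext n
    cases n with
    | zero => simp [cat_cons_zero]
    | succ n => simp [cat_cons_succ, h]

lemma cat_append (s t : List Bool) (η : Cantor) : cat (s ++ t) η = cat s (cat t η) := by
  induction s with
  | nil => simp [cat_nil]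
  | cons b s ih => exact cat_cons_inj.2 ⟨rfl, ih⟩

lemma cat_inj {s : List Bool} {η ζ : Cantor} : cat s η = cat s ζ ↔ η = ζ := by
  induction s with
  | nil => simp [cat_nil]
  | cons b s ih => simp [cat_cons_inj, ih]

lemma exists_eq_cat_singleton (ξ : Cantor) : ∃ b η, ξ = cat [b] η := by
  refine ⟨ξ 0, fun n => ξ (n + 1), funext fun n => ?_⟩
  cases n with
  | zero => simp [cat_cons_zero]
  | succ n => simp [cat_cons_succ, cat_nil]

lemma exists_eq_cat_length (n : ℕ) (ξ : Cantor) :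
    ∃ s η, s.length = n ∧ ξ = cat s η := by
  induction n generalizing ξ with
  | zero => exact ⟨[], ξ, rfl, (cat_nil ξ).symm⟩
  | succ n ih =>
    obtain ⟨b, η, rfl⟩ := exists_eq_cat_singleton ξ
    obtain ⟨s, ζ, hs, rfl⟩ := ih η
    exact ⟨b :: s, ζ, by simp [hs], by rw [← cat_append]; rfl⟩

lemma exists_append_of_cat_eq {s t : List Bool} {η ζ : Cantor} (h : cat s η = cat t ζ)
    (hl : s.length ≤ t.length) : ∃ r, t = s ++ r := by
  induction s generalizing t with
  | nil => exact ⟨t, rfl⟩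
  | cons a s ih =>
    cases t with
    | nil => simp at hl
    | cons b t =>
      obtain ⟨rfl, hst⟩ := cat_cons_inj.1 h
      obtain ⟨r, rfl⟩ := ih hst (by simpa using hl)
      exact ⟨r, rfl⟩

/-- The set of infinite sequences with prefix `s`. -/
def cone (s : List Bool) : Set Cantor := Set.range (cat s)

lemma isPrefixOf_iff {s : List Bool} {ξ : Cantor} : IsPrefixOf s ξ ↔ ξ ∈ cone s := by
  simp [IsPrefixOf, cone, eq_comm]

lemma cat_mem_cone (s : List Bool) (η : Cantor) : cat s η ∈ cone s := ⟨η, rfl⟩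

lemma cone_append_subset (s t : List Bool) : cone (s ++ t) ⊆ cone s := by
  rintro _ ⟨η, rfl⟩
  rw [cat_append]
  exact cat_mem_cone _ _

lemma disjoint_cone_of_branch (u v w : List Bool) {a b : Bool} (h : a ≠ b) :
    Disjoint (cone (u ++ a :: v)) (cone (u ++ b :: w)) := by
  rw [Set.disjoint_left]
  rintro _ ⟨η, rfl⟩ ⟨ζ, hζ⟩
  rw [cat_append, cat_append, cat_inj, cat_cons_inj] at hζ
  exact h hζ.1.symm

lemma not_disjoint_cone_append (s r : List Bool) :
    ¬ Disjoint (cone s) (cone (s ++ r)) := fun h =>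
  Set.disjoint_left.1 h (cone_append_subset s r (cat_mem_cone _ fun _ => false))
    (cat_mem_cone _ _)

/-! ### The order on finite sequences -/

lemma seqLT_nil_right {s : List Bool} : seqLT s [] ↔ s ≠ [] := by
  simp [seqLT]

lemma not_seqLT_nil_left {t : List Bool} : ¬ seqLT [] t := by
  simp [seqLT]

lemma seqLT_cons_cons {a b : Bool} {s t : List Bool} :
    seqLT (a :: s) (b :: t) ↔ (a = false ∧ b = true) ∨ (a = b ∧ seqLT s t) := by
  constructor
  · rintro (⟨u, hu, h⟩ | ⟨u, v, w, h, h'⟩)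
    · simp only [List.cons_append, List.cons.injEq] at h
      exact Or.inr ⟨h.1, Or.inl ⟨u, hu, h.2⟩⟩
    · cases u with
      | nil =>
        simp only [List.nil_append, List.cons.injEq] at h h'
        exact Or.inl ⟨h.1, h'.1⟩
      | cons c u =>
        simp only [List.cons_append, List.cons.injEq] at h h'
        exact Or.inr ⟨h.1.trans h'.1.symm, Or.inr ⟨u, v, w, h.2, h'.2⟩⟩
  · rintro (⟨rfl, rfl⟩ | ⟨rfl, ⟨u, hu, rfl⟩ | ⟨u, v, w, rfl, rfl⟩⟩)
    · exact Or.inr ⟨[], s, t, rfl, rfl⟩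
    · exact Or.inl ⟨u, hu, rfl⟩
    · exact Or.inr ⟨a :: u, v, w, rfl, rfl⟩

lemma seqLT_trichotomous (s t : List Bool) : seqLT s t ∨ s = t ∨ seqLT t s := by
  induction s generalizing t with
  | nil => cases t <;> simp [seqLT_nil_right]
  | cons a s ih =>
    cases t with
    | nil => simp [seqLT_nil_right]
    | cons b t =>
      have := ih t
      cases a <;> cases b <;> simp [seqLT_cons_cons, this]

lemma seqLT_trans {s t r : List Bool} (h : seqLT s t) (h' : seqLT t r) : seqLT s r := by
  induction s generalizing t r with
  | nil => exact absurd h not_seqLT_nil_left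
  | cons a s ih =>
    cases r with
    | nil => simp [seqLT_nil_right]
    | cons c r =>
      cases t with
      | nil => exact absurd h' not_seqLT_nil_left
      | cons b t =>
        rw [seqLT_cons_cons] at h h' ⊢
        have := @ih t r
        cases a <;> cases b <;> cases c <;> simp_all

/-! ### Homeomorphisms supported in a set -/

/-- The homeomorphisms that fix every point outside `A`. -/
def supportedIn (A : Set Cantor) : Subgroup (Cantor ≃ₜ Cantor) where
  carrier := {f | ∀ ξ, ξ ∉ A → f ξ = ξ}
  mul_mem' := fun {f g} hf hg ξ hξ => by
    rw [homeo_mul_apply, hg ξ hξ, hf ξ hξ]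
  one_mem' := fun _ _ => rfl
  inv_mem' := fun {f} hf ξ hξ => by
    rw [homeo_inv_apply, Homeomorph.symm_apply_eq, hf ξ hξ]

lemma supportedIn_mono {A B : Set Cantor} (h : A ⊆ B) : supportedIn A ≤ supportedIn B :=
  fun _ hf ξ hξ => hf ξ fun hA => hξ (h hA)

lemma commute_of_disjoint {A B : Set Cantor} (h : Disjoint A B) {f g : Cantor ≃ₜ Cantor}
    (hf : f ∈ supportedIn A) (hg : g ∈ supportedIn B) : Commute f g := by
  have hd : Equiv.Perm.Disjoint f.toEquiv g.toEquiv := fun ξ => by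
    by_cases hξ : ξ ∈ A
    · exact Or.inr (hg ξ (Set.disjoint_left.1 h hξ))
    · exact Or.inl (hf ξ hξ)
  exact Homeomorph.ext fun ξ => congrArg (fun e : Equiv.Perm Cantor => e ξ) hd.commute.eq

variable (D : LMData)

lemma xx_mem_supportedIn (s : List Bool) : D.xx s ∈ supportedIn (cone s) :=
  fun ξ hξ => D.hxx' s ξ (mt isPrefixOf_iff.1 hξ)

lemma yy_mem_supportedIn (s : List Bool) : D.yy s ∈ supportedIn (cone s) :=
  fun ξ hξ => D.hyy' s ξ (mt isPrefixOf_iff.1 hξ)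

lemma yy_inv_cat (s : List Bool) (η : Cantor) :
    (D.yy s)⁻¹ (cat s η) = cat s (D.y.symm η) := by
  rw [homeo_inv_apply, Homeomorph.symm_apply_eq, D.hyy, Homeomorph.apply_symm_apply]

lemma xx_mem_Tgrp (s : List Bool) : D.xx s ∈ Tgrp D :=
  Subgroup.subset_closure (Or.inl ⟨s, rfl⟩)

/-! ### Relations between the generators -/

/-- A homeomorphism acting as the prefix replacement `u ↦ v` conjugates `y_u` to `y_v`. -/
lemma semiconjBy_yy {f : Cantor ≃ₜ Cantor} {u v : List Bool}
    (h : ∀ η, f (cat u η) = cat v η) : SemiconjBy f (D.yy u) (D.yy v) := by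
  refine Homeomorph.ext fun ξ => ?_
  simp only [homeo_mul_apply]
  by_cases hξ : ξ ∈ cone u
  · obtain ⟨η, rfl⟩ := hξ
    rw [D.hyy, h, h, D.hyy]
  · rw [yy_mem_supportedIn D u ξ hξ, yy_mem_supportedIn D v]
    rintro ⟨η, hη⟩
    rw [← h] at hη
    exact hξ ⟨η, f.injective hη⟩

lemma yy_eq (s : List Bool) :
    D.yy s = D.yy (s ++ [false]) * (D.yy (s ++ [true, false]))⁻¹ *
      D.yy (s ++ [true, true]) * D.xx s := by
  have off : ∀ (u v w : List Bool) (a b : Bool) (η : Cantor), a ≠ b →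
      cat (u ++ a :: v) η ∉ cone (u ++ b :: w) := fun u v w a b η hab =>
    Set.disjoint_left.1 (disjoint_cone_of_branch u v w hab) (cat_mem_cone _ _)
  have off' : ∀ (v w : List Bool) (a b : Bool) (η : Cantor), a ≠ b →
      cat (s ++ true :: a :: v) η ∉ cone (s ++ true :: b :: w) := fun v w a b η hab => by
    simpa using off (s ++ [true]) v w a b η hab
  have f0 := yy_mem_supportedIn D (s ++ [false])
  have f10 := inv_mem (yy_mem_supportedIn D (s ++ [true, false]))
  have f11 := yy_mem_supportedIn D (s ++ [true, true])
  refine Homeomorph.ext fun ξ => ?_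
  simp only [homeo_mul_apply]
  by_cases hξ : ξ ∈ cone s
  · obtain ⟨η, rfl⟩ := hξ
    rw [D.hxx, D.hyy]
    obtain ⟨b, η, rfl⟩ := exists_eq_cat_singleton η
    cases b
    · obtain ⟨b, η, rfl⟩ := exists_eq_cat_singleton η
      rw [← cat_append [false]]
      cases b
      · simp only [List.singleton_append]
        rw [D.hx00, D.hy00, ← cat_append, ← cat_append, f11 _ (off _ _ _ _ _ _ (by decide)),
          f10 _ (off _ _ _ _ _ _ (by decide)), D.hyy]
      · simp only [List.singleton_append]
        rw [D.hx01, D.hy01, ← cat_append, ← cat_append, f11 _ (off' _ _ _ _ _ (by decide)),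
          yy_inv_cat, f0 _ (off _ _ _ _ _ _ (by decide))]
    · rw [D.hx1, D.hy1, ← cat_append, ← cat_append, D.hyy,
        f10 _ (off' _ _ _ _ _ (by decide)), f0 _ (off _ _ _ _ _ _ (by decide))]
  · rw [yy_mem_supportedIn D s ξ hξ, xx_mem_supportedIn D s ξ hξ,
      f11 ξ fun h => hξ (cone_append_subset _ _ h), f10 ξ fun h => hξ (cone_append_subset _ _ h),
      f0 ξ fun h => hξ (cone_append_subset _ _ h)]

lemma yy_inv_eq (s : List Bool) :
    (D.yy s)⁻¹ = (D.yy (s ++ [true]))⁻¹ * D.yy (s ++ [false, true]) *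
      (D.yy (s ++ [false, false]))⁻¹ * (D.xx s)⁻¹ := by
  have h1 : SemiconjBy (D.xx s) (D.yy (s ++ [true])) (D.yy (s ++ [true, true])) :=
    semiconjBy_yy D fun η => by rw [cat_append, D.hxx, D.hx1, cat_append]
  have h01 : SemiconjBy (D.xx s) (D.yy (s ++ [false, true])) (D.yy (s ++ [true, false])) :=
    semiconjBy_yy D fun η => by rw [cat_append, D.hxx, D.hx01, cat_append]
  have h00 : SemiconjBy (D.xx s) (D.yy (s ++ [false, false])) (D.yy (s ++ [false])) :=
    semiconjBy_yy D fun η => by rw [cat_append, D.hxx, D.hx00, cat_append]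
  have h := ((h1.inv_right.mul_right h01).mul_right h00.inv_right).eq
  rw [← mul_right_inj (D.xx s), ← mul_assoc, h, yy_eq D s]
  group

/-! ### Expanding `y_s` into deep generators -/

/-- The product of the powers `y_u ^ t` over the pairs `(u, t)` of a list. -/
def yyProd (W : List (List Bool × ℤ)) : Cantor ≃ₜ Cantor :=
  (W.map fun w => D.yy w.1 ^ w.2).prod

lemma yyProd_append (V W : List (List Bool × ℤ)) :
    yyProd D (V ++ W) = yyProd D V * yyProd D W := by
  simp [yyProd]

lemma yyProd_mem_supportedIn {A : Set Cantor} {W : List (List Bool × ℤ)}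
    (h : ∀ w ∈ W, cone w.1 ⊆ A) : yyProd D W ∈ supportedIn A := by
  refine list_prod_mem fun g hg => ?_
  obtain ⟨w, hw, rfl⟩ := List.mem_map.1 hg
  exact zpow_mem (supportedIn_mono (h w hw) (yy_mem_supportedIn D w.1)) _

/-- `g` is an element of `T` supported in `A`, followed by a product of powers of `y_u` whose
cones are pairwise disjoint subsets of `A` and whose indices `u` have length at least `k`. -/
def Expands (k : ℕ) (A : Set Cantor) (g : Cantor ≃ₜ Cantor) : Prop :=
  ∃ (W : List (List Bool × ℤ)) (h : Cantor ≃ₜ Cantor), h ∈ Tgrp D ∧ h ∈ supportedIn A ∧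
    (∀ w ∈ W, cone w.1 ⊆ A) ∧ (∀ w ∈ W, k ≤ w.1.length) ∧
    W.Pairwise (fun v w => Disjoint (cone v.1) (cone w.1)) ∧ g = yyProd D W * h

variable {D}

lemma Expands.mono {k : ℕ} {A B : Set Cantor} {g : Cantor ≃ₜ Cantor} (hg : Expands D k A g)
    (h : A ⊆ B) : Expands D k B g := by
  obtain ⟨W, f, hf, hfA, hA, hk, hW, rfl⟩ := hg
  exact ⟨W, f, hf, supportedIn_mono h hfA, fun w hw => (hA w hw).trans h, hk, hW, rfl⟩

lemma Expands.mul_right {k : ℕ} {A : Set Cantor} {g f : Cantor ≃ₜ Cantor}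
    (hg : Expands D k A g) (hf : f ∈ Tgrp D) (hfA : f ∈ supportedIn A) :
    Expands D k A (g * f) := by
  obtain ⟨W, h, hh, hhA, hA, hk, hW, rfl⟩ := hg
  exact ⟨W, h * f, mul_mem hh hf, mul_mem hhA hfA, hA, hk, hW, mul_assoc _ _ _⟩

lemma Expands.mul {k : ℕ} {A B : Set Cantor} {f g : Cantor ≃ₜ Cantor}
    (hf : Expands D k A f) (hg : Expands D k B g) (hAB : Disjoint A B) :
    Expands D k (A ∪ B) (f * g) := by
  obtain ⟨V, a, ha, haA, hVA, hVk, hV, rfl⟩ := hf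
  obtain ⟨W, b, hb, hbB, hWB, hWk, hW, rfl⟩ := hg
  refine ⟨V ++ W, a * b, mul_mem ha hb,
    mul_mem (supportedIn_mono Set.subset_union_left haA)
      (supportedIn_mono Set.subset_union_right hbB), ?_, ?_, ?_, ?_⟩
  · intro w hw
    rcases List.mem_append.1 hw with hw | hw
    · exact (hVA w hw).trans Set.subset_union_left
    · exact (hWB w hw).trans Set.subset_union_right
  · intro w hw
    exact (List.mem_append.1 hw).elim (hVk w) (hWk w)
  · exact List.pairwise_append.2
      ⟨hV, hW, fun v hv w hw => hAB.mono (hVA v hv) (hWB w hw)⟩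
  · have hc := (commute_of_disjoint hAB haA (yyProd_mem_supportedIn D hWB)).eq
    rw [yyProd_append, mul_assoc, ← mul_assoc a, hc]
    simp only [mul_assoc]

lemma expands_yy_zpow (s : List Bool) (t : ℤ) :
    Expands D s.length (cone s) (D.yy s ^ t) :=
  ⟨[(s, t)], 1, one_mem _, one_mem _, by simp, by simp, by simp, by simp [yyProd]⟩

lemma Expands.mul_of_subset {k : ℕ} {A B C : Set Cantor} {f g h : Cantor ≃ₜ Cantor}
    {U : Set Cantor} (hf : Expands D k A f) (hg : Expands D k B g) (hh : Expands D k C h)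
    (hAB : Disjoint A B) (hAC : Disjoint A C) (hBC : Disjoint B C)
    (hA : A ⊆ U) (hB : B ⊆ U) (hC : C ⊆ U) : Expands D k U (f * g * h) :=
  ((hf.mul hg hAB).mul hh (Set.disjoint_union_left.2 ⟨hAC, hBC⟩)).mono
    (Set.union_subset (Set.union_subset hA hB) hC)

lemma Expands.mono_left {k l : ℕ} {A : Set Cantor} {g : Cantor ≃ₜ Cantor}
    (hg : Expands D l A g) (h : k ≤ l) : Expands D k A g := by
  obtain ⟨W, f, hf, hfA, hA, hk, hW, rfl⟩ := hg
  exact ⟨W, f, hf, hfA, hA, fun w hw => h.trans (hk w hw), hW, rfl⟩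

variable (D)

lemma expands_yy (k : ℕ) (s : List Bool) :
    Expands D (s.length + k) (cone s) (D.yy s) ∧
      Expands D (s.length + k) (cone s) (D.yy s)⁻¹ := by
  induction k generalizing s with
  | zero => exact ⟨by simpa using expands_yy_zpow (D := D) s 1,
      by simpa using expands_yy_zpow (D := D) s (-1)⟩
  | succ k ih =>
    have ih' : ∀ r : List Bool, r ≠ [] →
        Expands D (s.length + (k + 1)) (cone (s ++ r)) (D.yy (s ++ r)) ∧
        Expands D (s.length + (k + 1)) (cone (s ++ r)) (D.yy (s ++ r))⁻¹ := fun r hr => by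
      have hl : s.length + (k + 1) ≤ (s ++ r).length + k := by
        have := List.length_pos_of_ne_nil hr
        simp only [List.length_append]
        omega
      exact ⟨(ih _).1.mono_left hl, (ih _).2.mono_left hl⟩
    have sub := cone_append_subset s
    have disj : ∀ (v w : List Bool) (c a b : Bool), a ≠ b →
        Disjoint (cone (s ++ c :: a :: v)) (cone (s ++ c :: b :: w)) := fun v w c a b hab => by
      simpa using disjoint_cone_of_branch (s ++ [c]) v w hab
    constructor
    · rw [yy_eq]
      exact ((ih' [false] (by simp)).1.mul_of_subset (ih' [true, false] (by simp)).2
        (ih' [true, true] (by simp)).1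
        (disjoint_cone_of_branch _ _ _ (by decide)) (disjoint_cone_of_branch _ _ _ (by decide))
        (disj _ _ _ _ _ (by decide)) (sub _) (sub _) (sub _)).mul_right
        (xx_mem_Tgrp D s) (xx_mem_supportedIn D s)
    · rw [yy_inv_eq]
      exact ((ih' [true] (by simp)).2.mul_of_subset (ih' [false, true] (by simp)).1
        (ih' [false, false] (by simp)).2
        (disjoint_cone_of_branch _ _ _ (by decide)) (disjoint_cone_of_branch _ _ _ (by decide))
        (disj _ _ _ _ _ (by decide)) (sub _) (sub _) (sub _)).mul_right
        (inv_mem (xx_mem_Tgrp D s)) (inv_mem (xx_mem_supportedIn D s))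

/-! ### Elements of `T` act on deep prefixes -/

/-- `f` is given by finitely many prefix replacements, of prefixes of length at most `d`. -/
def IsPrefixExchange (d : ℕ) (f : Cantor ≃ₜ Cantor) : Prop :=
  ∀ ξ, ∃ a b : List Bool, a.length ≤ d ∧ b.length ≤ d ∧ ξ ∈ cone a ∧
    ∀ η, f (cat a η) = cat b η

lemma IsPrefixExchange.inv {d : ℕ} {f : Cantor ≃ₜ Cantor} (hf : IsPrefixExchange d f) :
    IsPrefixExchange d f⁻¹ := by
  intro ξ
  obtain ⟨a, b, ha, hb, ⟨η, hη⟩, h⟩ := hf (f.symm ξ)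
  refine ⟨b, a, hb, ha, ⟨η, ?_⟩, fun ζ => ?_⟩
  · rw [← h, hη, Homeomorph.apply_symm_apply]
  · rw [homeo_inv_apply, ← h, Homeomorph.symm_apply_apply]

/-- `f` replaces every sufficiently long prefix by a prefix of length at least `m`, for all `m`. -/
def ActsOnDeep (f : Cantor ≃ₜ Cantor) : Prop :=
  ∀ m, ∃ d, ∀ u : List Bool, d ≤ u.length → ∃ v : List Bool, m ≤ v.length ∧
    ∀ η, f (cat u η) = cat v η

lemma IsPrefixExchange.actsOnDeep {d : ℕ} {f : Cantor ≃ₜ Cantor} (hf : IsPrefixExchange d f) :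
    ActsOnDeep f := by
  refine fun m => ⟨d + m, fun u hu => ?_⟩
  obtain ⟨a, b, ha, -, ⟨η, hη⟩, h⟩ := hf (cat u fun _ => false)
  obtain ⟨r, rfl⟩ := exists_append_of_cat_eq hη (by omega)
  refine ⟨b ++ r, ?_, fun ζ => by rw [cat_append, h, cat_append]⟩
  simp only [List.length_append] at hu ⊢
  omega

lemma ActsOnDeep.mul {f g : Cantor ≃ₜ Cantor} (hf : ActsOnDeep f) (hg : ActsOnDeep g) :
    ActsOnDeep (f * g) := by
  intro m
  obtain ⟨d, hd⟩ := hf m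
  obtain ⟨e, he⟩ := hg d
  refine ⟨e, fun u hu => ?_⟩
  obtain ⟨v, hv, hgv⟩ := he u hu
  obtain ⟨w, hw, hfw⟩ := hd v hv
  exact ⟨w, hw, fun η => by rw [homeo_mul_apply, hgv, hfw]⟩

lemma isPrefixExchange_xx (s : List Bool) : IsPrefixExchange (s.length + 2) (D.xx s) := by
  intro ξ
  by_cases hξ : ξ ∈ cone s
  · obtain ⟨η, rfl⟩ := hξ
    have key : ∀ a b : List Bool, a.length ≤ 2 → b.length ≤ 2 →
        (∀ η, D.x (cat a η) = cat b η) → ∀ η, ∃ a' b' : List Bool, a'.length ≤ s.length + 2 ∧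
          b'.length ≤ s.length + 2 ∧ cat s (cat a η) ∈ cone a' ∧
          ∀ η, D.xx s (cat a' η) = cat b' η := fun a b ha hb h η =>
      ⟨s ++ a, s ++ b, by simpa, by simpa, ⟨η, cat_append s a η⟩, fun ζ => by
        rw [cat_append, D.hxx, h, cat_append]⟩
    obtain ⟨b, η, rfl⟩ := exists_eq_cat_singleton η
    cases b
    · obtain ⟨b, η, rfl⟩ := exists_eq_cat_singleton η
      rw [← cat_append [false]]
      cases b
      · exact key _ _ (by simp) (by simp) D.hx00 _
      · exact key _ _ (by simp) (by simp) D.hx01 _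
    · exact key _ _ (by simp) (by simp) D.hx1 _
  · obtain ⟨a, η, ha, rfl⟩ := exists_eq_cat_length s.length ξ
    refine ⟨a, a, by omega, by omega, cat_mem_cone _ _, fun ζ => xx_mem_supportedIn D s _ ?_⟩
    rintro ⟨θ, hθ⟩
    obtain ⟨r, rfl⟩ := exists_append_of_cat_eq hθ ha.ge
    exact hξ (cone_append_subset _ _ (cat_mem_cone _ _))

lemma mem_cone_replicate (n : ℕ) (ξ : Cantor) :
    ξ ∈ cone (List.replicate (n + 1) true) ∨
      ∃ k ≤ n, ξ ∈ cone (List.replicate k true ++ [false]) := by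
  induction n with
  | zero =>
    obtain ⟨b, η, rfl⟩ := exists_eq_cat_singleton ξ
    cases b
    · exact Or.inr ⟨0, le_rfl, cat_mem_cone _ _⟩
    · exact Or.inl (cat_mem_cone _ _)
  | succ n ih =>
    rcases ih with ⟨η, rfl⟩ | ⟨k, hk, h⟩
    · obtain ⟨b, η, rfl⟩ := exists_eq_cat_singleton η
      rw [← cat_append]
      cases b
      · exact Or.inr ⟨n + 1, le_rfl, cat_mem_cone _ _⟩
      · rw [List.replicate_succ' (n := n + 1)]
        exact Or.inl (cat_mem_cone _ _)
    · exact Or.inr ⟨k, by omega, h⟩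

lemma isPrefixExchange_p (n : ℕ) : IsPrefixExchange (n + 1) (D.p n) := by
  intro ξ
  rcases mem_cone_replicate n ξ with h | ⟨k, hk, h⟩
  · exact ⟨_, [false], by simp, by simp, h, D.hp3 n⟩
  · rcases hk.lt_or_eq with hk | rfl
    · exact ⟨_, _, by simp; omega, by simp; omega, h, fun η => D.hp1 n k η hk⟩
    · exact ⟨_, _, by simp, by simp, h, D.hp2 k⟩

variable {D}

lemma actsOnDeep_of_mem_Tgrp {f : Cantor ≃ₜ Cantor} (hf : f ∈ Tgrp D) : ActsOnDeep f := by
  have gen : ∀ g ∈ Set.range D.xx ∪ Set.range D.p, ∃ d, IsPrefixExchange d g := by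
    rintro _ (⟨s, rfl⟩ | ⟨n, rfl⟩)
    · exact ⟨_, isPrefixExchange_xx D s⟩
    · exact ⟨_, isPrefixExchange_p D n⟩
  induction hf using Subgroup.closure_induction_right with
  | one => exact fun m => ⟨m, fun u hu => ⟨u, hu, fun _ => rfl⟩⟩
  | mul_right x hx y hy ih =>
    obtain ⟨d, hd⟩ := gen y hy
    exact ih.mul hd.actsOnDeep
  | mul_inv_cancel x hx y hy ih =>
    obtain ⟨d, hd⟩ := gen y hy
    exact ih.mul hd.inv.actsOnDeep

variable (D)

/-- Moving an element of `T` past a product of deep generators. -/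
lemma exists_mul_yyProd_eq {f : Cantor ≃ₜ Cantor} (hf : ActsOnDeep f) (m : ℕ) :
    ∃ d, ∀ W : List (List Bool × ℤ), (∀ w ∈ W, d ≤ w.1.length) →
      W.Pairwise (fun v w => Disjoint (cone v.1) (cone w.1)) →
      ∃ V : List (List Bool × ℤ), (∀ v ∈ V, m ≤ v.1.length) ∧
        V.Pairwise (fun v w => Disjoint (cone v.1) (cone w.1)) ∧
        f * yyProd D W = yyProd D V * f := by
  obtain ⟨d, hd⟩ := hf m
  choose! φ hφm hφ using hd
  refine ⟨d, fun W hWd hW => ⟨W.map fun w => (φ w.1, w.2), ?_, ?_, ?_⟩⟩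
  · intro v hv
    obtain ⟨w, hw, rfl⟩ := List.mem_map.1 hv
    exact hφm _ (hWd w hw)
  · refine List.pairwise_map.2 (hW.imp_of_mem fun {v w} hv hw h => ?_)
    rw [Set.disjoint_left] at h ⊢
    rintro _ ⟨η, rfl⟩ ⟨ζ, hζ⟩
    rw [← hφ _ (hWd _ hv), ← hφ _ (hWd _ hw)] at hζ
    exact h (cat_mem_cone _ η) ⟨ζ, f.injective hζ⟩
  · clear hW
    induction W with
    | nil => simp [yyProd]
    | cons w W ih =>
      have hw := (semiconjBy_yy D (hφ w.1 (hWd w (by simp)))).zpow_right w.2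
      have ih := ih fun v hv => hWd v (by simp [hv])
      simp only [yyProd, List.map_cons, List.prod_cons] at ih ⊢
      rw [← mul_assoc, hw.eq, mul_assoc, ih, mul_assoc]

/-! ### Standard forms -/

/-- The pairs of the list have strictly increasing first components. -/
def IsStandard (L : List (List Bool × ℤ)) : Prop :=
  L.Pairwise fun a b => seqLT a.1 b.1

lemma exists_insert (L : List (List Bool × ℤ)) (hL : IsStandard L) (u : List Bool) (t : ℤ)
    (hu : ∀ a ∈ L, ∀ r, r ≠ [] → a.1 ≠ u ++ r) :
    ∃ L', IsStandard L' ∧ (∀ b ∈ L', b.1 = u ∨ ∃ a ∈ L, b.1 = a.1) ∧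
      yyProd D L.reverse * D.yy u ^ t = yyProd D L'.reverse := by
  induction L with
  | nil => exact ⟨[(u, t)], by simp [IsStandard], by simp, by simp [yyProd]⟩
  | cons a L ih =>
    obtain ⟨haL, hL'⟩ := List.pairwise_cons.1 hL
    rcases seqLT_trichotomous a.1 u with h | h | h
    · obtain ⟨M, hM, hMu, hprod⟩ := ih hL' fun b hb => hu b (by simp [hb])
      have hcomm : Commute (D.yy a.1 ^ a.2) (D.yy u ^ t) := by
        refine (commute_of_disjoint ?_ (yy_mem_supportedIn D _)
          (yy_mem_supportedIn D _)).zpow_zpow _ _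
        rcases h with ⟨r, hr, h⟩ | ⟨r, v, w, h, rfl⟩
        · exact absurd h (hu a (by simp) r hr)
        · rw [h]
          exact disjoint_cone_of_branch _ _ _ (by decide)
      refine ⟨a :: M, List.pairwise_cons.2 ⟨fun b hb => ?_, hM⟩, fun b hb => ?_, ?_⟩
      · rcases hMu b hb with hb | ⟨c, hc, hb⟩
        · rwa [hb]
        · rw [hb]
          exact haL c hc
      · rcases List.mem_cons.1 hb with rfl | hb
        · exact Or.inr ⟨b, by simp, rfl⟩
        · exact (hMu b hb).imp_right fun ⟨c, hc, h⟩ => ⟨c, by simp [hc], h⟩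
      · rw [List.reverse_cons, List.reverse_cons, yyProd_append, yyProd_append, ← hprod,
          mul_assoc, mul_assoc]
        simp [yyProd, hcomm.eq]
    · refine ⟨(u, a.2 + t) :: L, List.pairwise_cons.2 ⟨fun b hb => ?_, hL'⟩, fun b hb => ?_, ?_⟩
      · rw [← h]
        exact haL b hb
      · rcases List.mem_cons.1 hb with rfl | hb
        · exact Or.inl rfl
        · exact Or.inr ⟨b, by simp [hb], rfl⟩
      · rw [List.reverse_cons, List.reverse_cons, yyProd_append, yyProd_append, mul_assoc]
        simp [yyProd, h, zpow_add]
    · refine ⟨(u, t) :: a :: L, List.pairwise_cons.2 ⟨fun b hb => ?_, hL⟩, fun b hb => ?_, ?_⟩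
      · rcases List.mem_cons.1 hb with rfl | hb
        · exact h
        · exact seqLT_trans h (haL b hb)
      · rcases List.mem_cons.1 hb with rfl | hb
        · exact Or.inl rfl
        · exact Or.inr ⟨b, hb, rfl⟩
      · rw [List.reverse_cons (a := (u, t)), yyProd_append]
        simp [yyProd]

lemma exists_insert_list (W L : List (List Bool × ℤ)) (hL : IsStandard L)
    (hW : W.Pairwise fun v w => Disjoint (cone v.1) (cone w.1))
    (hWL : ∀ w ∈ W, ∀ a ∈ L, ∀ r, r ≠ [] → a.1 ≠ w.1 ++ r) :
    ∃ L', IsStandard L' ∧ yyProd D L.reverse * yyProd D W = yyProd D L'.reverse := by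
  induction W generalizing L with
  | nil => exact ⟨L, hL, by simp [yyProd]⟩
  | cons w W ih =>
    obtain ⟨hw, hW⟩ := List.pairwise_cons.1 hW
    obtain ⟨M, hM, hMw, hprod⟩ := exists_insert D L hL w.1 w.2 (hWL w (by simp))
    obtain ⟨N, hN, hprod'⟩ := ih M hM hW fun v hv b hb r hr hbv => by
      rcases hMw b hb with h | ⟨a, ha, h⟩
      · have := (hw v hv).symm
        rw [← h, hbv] at this
        exact not_disjoint_cone_append _ _ this
      · exact hWL v (by simp [hv]) a ha r hr (h.symm.trans hbv)
    refine ⟨N, hN, ?_⟩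
    rw [← hprod', ← hprod, mul_assoc]
    simp [yyProd]

/-- `g` is an element of `T` followed by a product of powers of `y_s` in increasing order. -/
def HasStandardForm (g : Cantor ≃ₜ Cantor) : Prop :=
  ∃ (L : List (List Bool × ℤ)) (f : Cantor ≃ₜ Cantor), IsStandard L ∧ f ∈ Tgrp D ∧
    g = yyProd D L.reverse * f

variable {D}

lemma HasStandardForm.mul_Tgrp {g h : Cantor ≃ₜ Cantor} (hg : HasStandardForm D g)
    (hh : h ∈ Tgrp D) : HasStandardForm D (g * h) := by
  obtain ⟨L, f, hL, hf, rfl⟩ := hg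
  exact ⟨L, f * h, hL, mul_mem hf hh, mul_assoc _ _ _⟩

lemma HasStandardForm.mul_of_expands {g h : Cantor ≃ₜ Cantor} {A : Set Cantor}
    (hg : HasStandardForm D g) (hh : ∀ k, Expands D k A h) : HasStandardForm D (g * h) := by
  obtain ⟨L, f, hL, hf, rfl⟩ := hg
  obtain ⟨m, hm⟩ : ∃ m, ∀ a ∈ L, a.1.length ≤ m :=
    ⟨(L.map fun a => a.1.length).sum, fun a ha =>
      List.single_le_sum (by simp) _ (List.mem_map.2 ⟨a, ha, rfl⟩)⟩
  obtain ⟨d, hd⟩ := exists_mul_yyProd_eq D (actsOnDeep_of_mem_Tgrp hf) m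
  obtain ⟨W, h, hT, -, -, hWd, hW, rfl⟩ := hh d
  obtain ⟨V, hVm, hV, hfW⟩ := hd W hWd hW
  obtain ⟨M, hM, hprod⟩ := exists_insert_list D V L hL hV fun v hv a ha r hr hav => by
    have h1 := hm a ha
    have h2 := hVm v hv
    have h3 := List.length_pos_of_ne_nil hr
    rw [hav, List.length_append] at h1
    omega
  refine ⟨M, f * h, hM, mul_mem hf hT, ?_⟩
  rw [← hprod, mul_assoc, ← mul_assoc f, hfW]
  simp only [mul_assoc]

lemma hasStandardForm_of_mem_Shat {g : Cantor ≃ₜ Cantor} (hg : g ∈ Shat D) :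
    HasStandardForm D g := by
  have hx := fun s => xx_mem_Tgrp D s
  have hp : ∀ n, D.p n ∈ Tgrp D := fun n => Subgroup.subset_closure (Or.inr ⟨n, rfl⟩)
  have hy : ∀ s k, Expands D k (cone s) (D.yy s) ∧ Expands D k (cone s) (D.yy s)⁻¹ :=
    fun s k => ⟨(expands_yy D k s).1.mono_left (by omega),
      (expands_yy D k s).2.mono_left (by omega)⟩
  induction hg using Subgroup.closure_induction_right with
  | one => exact ⟨[], 1, List.Pairwise.nil, one_mem _, by simp [yyProd]⟩
  | mul_right x _ y hy' ih =>
    rcases hy' with (⟨s, rfl⟩ | ⟨s, rfl⟩) | ⟨n, rfl⟩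
    · exact ih.mul_Tgrp (hx s)
    · exact ih.mul_of_expands fun k => (hy s k).1
    · exact ih.mul_Tgrp (hp n)
  | mul_inv_cancel x _ y hy' ih =>
    rcases hy' with (⟨s, rfl⟩ | ⟨s, rfl⟩) | ⟨n, rfl⟩
    · exact ih.mul_Tgrp (inv_mem (hx s))
    · exact ih.mul_of_expands fun k => (hy s k).2
    · exact ih.mul_Tgrp (inv_mem (hp n))

end LodhaMoore

/-- every element of `Ŝ` has a standard form `f y_{s₁}^{t₁} ⋯ y_{sₙ}^{tₙ}`
(right-action word, so in the composition order of the group it is the reversed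
product, applied after `f`). -/
theorem statement1 (D : LMData) (g : Cantor ≃ₜ Cantor) (hg : g ∈ Shat D) :
    ∃ (n : ℕ) (f : Cantor ≃ₜ Cantor) (t : Fin n → ℤ) (s : Fin n → List Bool),
      f ∈ Tgrp D ∧ (∀ i j : Fin n, i < j → seqLT (s i) (s j)) ∧
      g = (List.ofFn fun i => (D.yy (s i)) ^ (t i)).reverse.prod * f := by
  obtain ⟨L, f, hL, hf, rfl⟩ := LodhaMoore.hasStandardForm_of_mem_Shat hg
  refine ⟨L.length, f, fun i => (L.get i).2, fun i => (L.get i).1, hf,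
    fun i j hij => List.pairwise_iff_get.1 hL i j hij, ?_⟩
  have h : (List.ofFn fun i => D.yy (L.get i).1 ^ (L.get i).2) =
      L.map fun a => D.yy a.1 ^ a.2 := by
    rw [← Function.comp_def (fun a : List Bool × ℤ => D.yy a.1 ^ a.2) L.get, ← List.map_ofFn,
      List.ofFn_get]
  rw [h, LodhaMoore.yyProd, List.map_reverse]
end

section
/- The abelianization Ŝ/[Ŝ,Ŝ] of the group Ŝ is isomorphic to ℤ; moreover there is a group isomorphism Ŝ/[Ŝ,Ŝ] ≅ ℤ under which the image of y_s equals 1 for every s ∈ {0,1}^{<ℕ}. -/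
open Filter Topology PiNat

/-! ### Concatenation -/

@[simp] lemma cat_nil (η : Cantor) : cat [] η = η := by
  funext n; simp [cat]

lemma cat_singleton_zero (b : Bool) (η : Cantor) : cat [b] η 0 = b := by
  simp [cat]

lemma cat_singleton_succ (b : Bool) (η : Cantor) (n : ℕ) : cat [b] η (n + 1) = η n := by
  simp [cat]

@[simp] lemma cat_cons (b c : Bool) (s : List Bool) (η : Cantor) :
    cat (b :: c :: s) η = cat [b] (cat (c :: s) η) := by
  funext n
  cases n with
  | zero => simp [cat]
  | succ n => rw [cat_singleton_succ]; simp [cat]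

lemma cat_cons_eq (b : Bool) (s : List Bool) (η : Cantor) :
    cat (b :: s) η = cat [b] (cat s η) := by
  cases s <;> simp

lemma cat_append (s t : List Bool) (η : Cantor) : cat (s ++ t) η = cat s (cat t η) := by
  induction s with
  | nil => simp
  | cons b s ih => rw [List.cons_append, cat_cons_eq, ih, ← cat_cons_eq]

lemma cat_singleton_inj {b c : Bool} {ξ η : Cantor} :
    cat [b] ξ = cat [c] η ↔ b = c ∧ ξ = η := by
  constructor
  · intro h
    refine ⟨by simpa [cat_singleton_zero] using congrFun h 0, funext fun n => ?_⟩
    simpa [cat_singleton_succ] using congrFun h (n + 1)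
  · rintro ⟨rfl, rfl⟩; rfl

lemma cat_injective (s : List Bool) : Function.Injective (cat s) := by
  induction s with
  | nil => intro ξ η h; simpa using h
  | cons b s ih =>
    intro ξ η h
    rw [cat_cons_eq b s ξ, cat_cons_eq b s η, cat_singleton_inj] at h
    exact ih h.2

lemma exists_cat_singleton (ξ : Cantor) : ∃ b η, ξ = cat [b] η := by
  refine ⟨ξ 0, fun n => ξ (n + 1), funext fun n => ?_⟩
  cases n <;> simp [cat_singleton_zero, cat_singleton_succ]

lemma continuous_tail : Continuous (fun (ξ : Cantor) (n : ℕ) => ξ (n + 1)) := by fun_prop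

lemma isOpenEmbedding_cat (s : List Bool) : IsOpenEmbedding (cat s) := by
  induction s with
  | nil =>
    have : cat [] = id := funext cat_nil
    rw [this]
    exact IsOpenEmbedding.id
  | cons b s ih =>
    have hcons : IsOpenEmbedding (cat [b]) := by
      refine ⟨Function.LeftInverse.isEmbedding (f := fun ξ n => ξ (n + 1))
        (fun η => funext fun n => cat_singleton_succ b η n) continuous_tail ?_, ?_⟩
      · refine continuous_pi fun n => ?_
        cases n with
        | zero => simpa only [cat_singleton_zero] using continuous_const
        | succ n => simpa only [cat_singleton_succ] using continuous_apply n
      · have : Set.range (cat [b]) = (fun ξ : Cantor => ξ 0) ⁻¹' {b} := by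
          ext ξ
          obtain ⟨c, η, rfl⟩ := exists_cat_singleton ξ
          simp only [Set.mem_range, cat_singleton_inj, Set.mem_preimage, cat_singleton_zero,
            Set.mem_singleton_iff]
          exact ⟨fun ⟨_, h, _⟩ => h.symm, fun h => ⟨η, h.symm, rfl⟩⟩
        rw [this]
        exact (isOpen_discrete _).preimage (continuous_apply 0)
    have : cat (b :: s) = cat [b] ∘ cat s := funext (cat_cons_eq b s)
    rw [this]
    exact hcons.comp ih

lemma nhdsNE_cat (s : List Bool) (a : Cantor) :
    𝓝[≠] (cat s a) = map (cat s) (𝓝[≠] a) := by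
  have he := isOpenEmbedding_cat s
  rw [he.isEmbedding.map_nhdsWithin_eq]
  have : cat s '' {a}ᶜ = {cat s a}ᶜ ∩ Set.range (cat s) := by
    ext ξ
    constructor
    · rintro ⟨η, hη, rfl⟩
      exact ⟨fun h => hη (cat_injective s h), η, rfl⟩
    · rintro ⟨h, η, rfl⟩
      exact ⟨η, fun h' => h (congrArg (cat s) h'), rfl⟩
  rw [this, nhdsWithin_inter_of_mem' (mem_nhdsWithin_of_mem_nhds
    (he.isOpen_range.mem_nhds ⟨a, rfl⟩))]

/-! ### Slopes -/

lemma firstDiff_eq_zero_of_ne {ξ a : Cantor} (h : ξ 0 ≠ a 0) : firstDiff ξ a = 0 := by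
  by_contra h0
  exact h (apply_eq_of_lt_firstDiff (Nat.pos_of_ne_zero h0))

lemma firstDiff_cat_singleton (b : Bool) {ξ a : Cantor} (h : ξ ≠ a) :
    firstDiff (cat [b] ξ) (cat [b] a) = firstDiff ξ a + 1 := by
  have h' : cat [b] ξ ≠ cat [b] a := fun e => h (cat_injective _ e)
  apply le_antisymm
  · by_contra! hlt
    have := apply_eq_of_lt_firstDiff hlt
    simp only [cat_singleton_succ] at this
    exact apply_firstDiff_ne h this
  · by_contra! hlt
    have hne := apply_firstDiff_ne h'
    rcases hn : firstDiff (cat [b] ξ) (cat [b] a) with _ | n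
    · simp [hn, cat_singleton_zero] at hne
    · rw [hn] at hne hlt
      simp only [cat_singleton_succ] at hne
      exact hne (apply_eq_of_lt_firstDiff (by omega))

lemma firstDiff_cat (s : List Bool) {ξ a : Cantor} (h : ξ ≠ a) :
    firstDiff (cat s ξ) (cat s a) = firstDiff ξ a + s.length := by
  induction s with
  | nil => simp
  | cons b s ih =>
    rw [cat_cons_eq b s ξ, cat_cons_eq b s a,
      firstDiff_cat_singleton b (fun e => h (cat_injective _ e)), ih]
    simp [add_assoc]

lemma tendsto_firstDiff (a : Cantor) :
    Tendsto (fun ξ => (firstDiff ξ a : ℝ)) (𝓝[≠] a) atTop := by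
  refine tendsto_natCast_atTop_atTop.comp (tendsto_atTop.2 fun n => ?_)
  have hmem : cylinder a n ∈ 𝓝 a := (isOpen_cylinder _ a n).mem_nhds (self_mem_cylinder a n)
  filter_upwards [mem_nhdsWithin_of_mem_nhds hmem, self_mem_nhdsWithin] with ξ hξ hne
  exact (mem_cylinder_iff_le_firstDiff hne n).1 hξ

instance nhdsNE_cantor_neBot (a : Cantor) : (𝓝[≠] a).NeBot := by
  have hne : ∀ n, Function.update a n (!a n) ∈ ({a}ᶜ : Set Cantor) := fun n h => by
    have := congrFun (Set.mem_singleton_iff.1 h) n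
    simp at this
  have ht : Tendsto (fun n => Function.update a n (!a n)) atTop (𝓝[≠] a) := by
    refine tendsto_nhdsWithin_iff.2 ⟨tendsto_pi_nhds.2 fun m => ?_, Eventually.of_forall hne⟩
    refine tendsto_const_nhds.congr' ?_
    filter_upwards [eventually_gt_atTop m] with n hn
    rw [Function.update_of_ne hn.ne]
  exact ht.neBot

/-- `f` rescales agreement with `a` asymptotically by the factor `r`. -/
def HasSlope (f : Cantor → Cantor) (a : Cantor) (r : ℝ) : Prop :=
  0 < r ∧ Tendsto (fun ξ => (firstDiff (f ξ) (f a) : ℝ) / firstDiff ξ a) (𝓝[≠] a) (𝓝 r)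

lemma eventually_firstDiff_pos (a : Cantor) : ∀ᶠ ξ in 𝓝[≠] a, (0 : ℝ) < firstDiff ξ a :=
  (tendsto_firstDiff a).eventually_gt_atTop 0

lemma hasSlope_id (a : Cantor) : HasSlope id a 1 := by
  refine ⟨one_pos, tendsto_const_nhds.congr' ?_⟩
  filter_upwards [eventually_firstDiff_pos a] with ξ hξ
  exact (div_self hξ.ne').symm

lemma tendsto_nhdsNE_homeo (f : Cantor ≃ₜ Cantor) (a : Cantor) :
    Tendsto f (𝓝[≠] a) (𝓝[≠] (f a)) :=
  f.continuous.continuousAt.continuousWithinAt.tendsto_nhdsWithin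
    fun _ h h' => h (f.injective h')

lemma HasSlope.comp {g : Cantor → Cantor} {f : Cantor ≃ₜ Cantor} {a : Cantor} {r q : ℝ}
    (hg : HasSlope g (f a) q) (hf : HasSlope f a r) : HasSlope (g ∘ f) a (q * r) := by
  refine ⟨mul_pos hg.1 hf.1,
    ((hg.2.comp (tendsto_nhdsNE_homeo f a)).mul hf.2).congr' ?_⟩
  filter_upwards [(tendsto_nhdsNE_homeo f a).eventually (eventually_firstDiff_pos (f a))]
    with ξ hξ
  simp only [Function.comp_apply]
  field_simp

lemma HasSlope.symm {f : Cantor ≃ₜ Cantor} {a : Cantor} {r : ℝ} (hf : HasSlope f a r) :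
    HasSlope f.symm (f a) r⁻¹ := by
  have ht : Tendsto f.symm (𝓝[≠] (f a)) (𝓝[≠] a) := by
    simpa using tendsto_nhdsNE_homeo f.symm (f a)
  refine ⟨inv_pos.2 hf.1, ((hf.2.comp ht).inv₀ hf.1.ne').congr fun ξ => ?_⟩
  simp

lemma HasSlope.cat {f g : Cantor → Cantor} {a : Cantor} {r : ℝ} {s t : List Bool}
    (hg : HasSlope g a r) (hinj : Function.Injective g)
    (hfg : ∀ η, f (cat s η) = cat t (g η)) : HasSlope f (cat s a) r := by
  refine ⟨hg.1, ?_⟩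
  rw [nhdsNE_cat, tendsto_map'_iff]
  have hs := (tendsto_const_nhds (x := (s.length : ℝ))).div_atTop (tendsto_firstDiff a)
  have ht := (tendsto_const_nhds (x := (t.length : ℝ))).div_atTop (tendsto_firstDiff a)
  have hlim := (hg.2.add ht).div (hs.const_add 1) (by simp)
  simp only [add_zero, div_one] at hlim
  refine hlim.congr' ?_
  filter_upwards [eventually_firstDiff_pos a, self_mem_nhdsWithin] with η hη hne
  simp only [Function.comp_apply, Pi.div_apply]
  rw [hfg, hfg, firstDiff_cat t (hinj.ne hne), firstDiff_cat s hne]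
  push_cast
  field_simp

lemma hasSlope_of_cat {f : Cantor → Cantor} {s t : List Bool}
    (h : ∀ η, f (cat s η) = cat t η) (a : Cantor) : HasSlope f (cat s a) 1 :=
  (hasSlope_id a).cat Function.injective_id h

lemma hasSlope_of_bound {f : Cantor → Cantor} {a : Cantor} {r : ℝ} (hr : 0 < r)
    (h : ∀ ξ, ξ ≠ a → |(firstDiff (f ξ) (f a) : ℝ) - r * firstDiff ξ a| ≤ 1) :
    HasSlope f a r := by
  refine ⟨hr, tendsto_iff_norm_sub_tendsto_zero.2 ?_⟩
  refine squeeze_zero' (Eventually.of_forall fun _ => norm_nonneg _) ?_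
    ((tendsto_const_nhds (x := (1 : ℝ))).div_atTop (tendsto_firstDiff a))
  filter_upwards [eventually_firstDiff_pos a, self_mem_nhdsWithin] with ξ hξ hne
  rw [Real.norm_eq_abs, div_sub' hξ.ne', abs_div, abs_of_pos hξ, mul_comm]
  exact div_le_div_of_nonneg_right (h ξ hne) hξ.le

/-- The slope of `f` at `a`, a junk value if there is none. -/
noncomputable def slopeAt (f : Cantor → Cantor) (a : Cantor) : ℝ :=
  limUnder (𝓝[≠] a) fun ξ => (firstDiff (f ξ) (f a) : ℝ) / firstDiff ξ a

lemma HasSlope.slopeAt_eq {f : Cantor → Cantor} {a : Cantor} {r : ℝ} (h : HasSlope f a r) :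
    slopeAt f a = r := h.2.limUnder_eq

/-! ### Gaps of the Cantor set -/

/-- The sequence `000…`. -/
def zeros : Cantor := fun _ => false

/-- The sequence `111…`. -/
def ones : Cantor := fun _ => true

lemma cat_false_zeros : cat [false] zeros = zeros := by
  funext n; cases n <;> simp [cat_singleton_zero, cat_singleton_succ, zeros]

lemma cat_true_ones : cat [true] ones = ones := by
  funext n; cases n <;> simp [cat_singleton_zero, cat_singleton_succ, ones]

lemma eq_zeros {ξ : Cantor} (h : ξ = cat [false] ξ) : ξ = zeros := by
  funext n
  induction n with
  | zero => rw [h, cat_singleton_zero]; rfl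
  | succ n ih => rw [h, cat_singleton_succ, ih]; rfl

lemma eq_ones {ξ : Cantor} (h : ξ = cat [true] ξ) : ξ = ones := by
  funext n
  induction n with
  | zero => rw [h, cat_singleton_zero]; rfl
  | succ n ih => rw [h, cat_singleton_succ, ih]; rfl

/-- The left end `t0111…` of the gap indexed by `t`. -/
def gapLeft (t : List Bool) : Cantor := cat t (cat [false] ones)

/-- The right end `t1000…` of the gap indexed by `t`. -/
def gapRight (t : List Bool) : Cantor := cat t (cat [true] zeros)

/-- The pairs of points of the Cantor set that are glued in the circle. -/
def Adj (p : Cantor × Cantor) : Prop :=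
  p = (ones, zeros) ∨ ∃ t, p = (gapLeft t, gapRight t)

open Classical in
/-- The ratio of the slopes of `f` at the two sides of `p`. -/
noncomputable def jump (f : Cantor → Cantor) (p : Cantor × Cantor) : ℝ :=
  if Adj p then slopeAt f p.1 / slopeAt f p.2 else 1

lemma jump_eq {f : Cantor → Cantor} {p : Cantor × Cantor} {l r : ℝ} (hp : Adj p)
    (hl : HasSlope f p.1 l) (hr : HasSlope f p.2 r) : jump f p = l / r := by
  rw [jump, if_pos hp, hl.slopeAt_eq, hr.slopeAt_eq]

/-- Homeomorphisms that respect the gluing, have slopes on both sides of each glued point,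
and have only finitely many nontrivial jumps. -/
structure IsTame (f : Cantor ≃ₜ Cantor) : Prop where
  adj_iff : ∀ p, Adj (Prod.map f f p) ↔ Adj p
  slopes : ∀ p, Adj p → (∃ l, HasSlope f p.1 l) ∧ ∃ r, HasSlope f p.2 r
  finite : (Function.mulSupport (jump f)).Finite

lemma jump_one : jump (1 : Cantor ≃ₜ Cantor) = 1 := by
  funext p
  by_cases hp : Adj p
  · exact (jump_eq hp (hasSlope_id _) (hasSlope_id _)).trans (div_one 1)
  · simp [jump, hp]

lemma jump_mul {f g : Cantor ≃ₜ Cantor} (hf : ∀ p, Adj (Prod.map f f p) ↔ Adj p)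
    (hfs : ∀ p, Adj p → (∃ l, HasSlope f p.1 l) ∧ ∃ r, HasSlope f p.2 r)
    (hgs : ∀ p, Adj p → (∃ l, HasSlope g p.1 l) ∧ ∃ r, HasSlope g p.2 r)
    (p : Cantor × Cantor) :
    jump (g * f : Cantor ≃ₜ Cantor) p = jump g (Prod.map f f p) * jump f p := by
  by_cases hp : Adj p
  · have hp' := (hf p).2 hp
    obtain ⟨⟨l, hl⟩, r, hr⟩ := hfs p hp
    obtain ⟨⟨l', hl'⟩, r', hr'⟩ := hgs _ hp'
    rw [jump_eq hp hl hr, jump_eq hp' hl' hr', ← mul_div_mul_comm]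
    exact jump_eq hp (hl'.comp hl) (hr'.comp hr)
  · rw [jump, jump, jump, if_neg hp, if_neg hp, if_neg (mt (hf p).1 hp), mul_one]

lemma mulSupport_comp_finite {f : Cantor ≃ₜ Cantor} {J : Cantor × Cantor → ℝ}
    (hJ : (Function.mulSupport J).Finite) :
    (Function.mulSupport fun p => J (Prod.map f f p)).Finite :=
  Set.Finite.preimage ((f.injective.prodMap f.injective).injOn) hJ

/-- The group of tame homeomorphisms. -/
def tameSubgroup : Subgroup (Cantor ≃ₜ Cantor) where
  carrier := {f | IsTame f}
  one_mem' := ⟨fun _ => Iff.rfl, fun _ _ => ⟨⟨1, hasSlope_id _⟩, 1, hasSlope_id _⟩, by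
    rw [jump_one]; simp⟩
  mul_mem' := by
    intro g f hg hf
    refine ⟨fun p => (hg.adj_iff (Prod.map f f p)).trans (hf.adj_iff p), fun p hp => ?_, ?_⟩
    · obtain ⟨⟨l, hl⟩, r, hr⟩ := hf.slopes p hp
      obtain ⟨⟨l', hl'⟩, r', hr'⟩ := hg.slopes _ ((hf.adj_iff p).2 hp)
      exact ⟨⟨_, hl'.comp hl⟩, _, hr'.comp hr⟩
    · rw [funext (jump_mul hf.adj_iff hf.slopes hg.slopes)]
      exact ((mulSupport_comp_finite hg.finite).union hf.finite).subset
        (Function.mulSupport_mul _ _)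
  inv_mem' := by
    intro f hf
    have hadj : ∀ p, Adj (Prod.map (f⁻¹ : Cantor ≃ₜ Cantor) (f⁻¹ : Cantor ≃ₜ Cantor) p) ↔ Adj p :=
      fun p => by
        rw [← hf.adj_iff]
        simp [Prod.map]
    have hs : ∀ p, Adj p → (∃ l, HasSlope (f⁻¹ : Cantor ≃ₜ Cantor) p.1 l) ∧
        ∃ r, HasSlope (f⁻¹ : Cantor ≃ₜ Cantor) p.2 r := fun p hp => by
      obtain ⟨⟨l, hl⟩, r, hr⟩ := hf.slopes _ ((hadj p).2 hp)
      have hl' := hl.symm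
      have hr' := hr.symm
      simp only [Prod.map_fst, Prod.map_snd, homeo_inv_apply, Homeomorph.apply_symm_apply]
        at hl' hr'
      exact ⟨⟨_, hl'⟩, _, hr'⟩
    refine ⟨hadj, hs, ?_⟩
    refine (mulSupport_comp_finite (f := f⁻¹) hf.finite).subset fun p hp h => hp ?_
    have := jump_mul hadj hs hf.slopes p
    rw [mul_inv_cancel, jump_one, show jump f _ = 1 from h, one_mul] at this
    exact this.symm

/-- The total jump of a tame homeomorphism. -/
noncomputable def totalJump : tameSubgroup →* ℝ where
  toFun f := ∏ᶠ p, jump f.1 p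
  map_one' := by
    have : jump (1 : tameSubgroup).1 = 1 := jump_one
    rw [this]; simp
  map_mul' g f := by
    have hf : IsTame f.1 := f.2
    have hg : IsTame g.1 := g.2
    have := funext (jump_mul hf.adj_iff hf.slopes hg.slopes)
    rw [Subgroup.coe_mul, this, finprod_mul_distrib (mulSupport_comp_finite hg.finite) hf.finite]
    congr 1
    exact finprod_comp_equiv (f.1.toEquiv.prodCongr f.1.toEquiv) (f := jump g.1)

lemma gapLeft_cons (b : Bool) (t : List Bool) : gapLeft (b :: t) = cat [b] (gapLeft t) :=
  cat_cons_eq b t _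

lemma gapRight_cons (b : Bool) (t : List Bool) : gapRight (b :: t) = cat [b] (gapRight t) :=
  cat_cons_eq b t _

lemma gapLeft_nil : gapLeft [] = cat [false] ones := cat_nil _

lemma gapRight_nil : gapRight [] = cat [true] zeros := cat_nil _

/-- `f` fixes `000…` and `111…` and maps gaps to gaps. -/
structure PreservesGaps (f : Cantor → Cantor) : Prop where
  map_zeros : f zeros = zeros
  map_ones : f ones = ones
  map_gap : ∀ t, ∃ t', f (gapLeft t) = gapLeft t' ∧ f (gapRight t) = gapRight t'

/-- `f` has slopes at `000…`, at `111…` and at both ends of each gap, and the two slopes agree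
at all but finitely many gaps. -/
structure HasGapSlopes (f : Cantor → Cantor) : Prop where
  slope_zeros : ∃ r, HasSlope f zeros r
  slope_ones : ∃ r, HasSlope f ones r
  slope_gap : ∀ t, (∃ l, HasSlope f (gapLeft t) l) ∧ ∃ r, HasSlope f (gapRight t) r
  finite : {t | ¬ ∃ r, HasSlope f (gapLeft t) r ∧ HasSlope f (gapRight t) r}.Finite

lemma PreservesGaps.adj {f : Cantor → Cantor} (hf : PreservesGaps f) {p : Cantor × Cantor}
    (hp : Adj p) : Adj (Prod.map f f p) := by
  rcases hp with rfl | ⟨t, rfl⟩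
  · exact Or.inl (by simp [hf.map_zeros, hf.map_ones])
  · obtain ⟨t', h₁, h₂⟩ := hf.map_gap t
    exact Or.inr ⟨t', by simp [h₁, h₂]⟩

lemma IsTame.of_gaps {f : Cantor ≃ₜ Cantor} (hf : ∀ p, Adj p → Adj (Prod.map f f p))
    (hf' : ∀ p, Adj p → Adj (Prod.map f.symm f.symm p)) (hs : HasGapSlopes f) : IsTame f where
  adj_iff p := ⟨fun h => by simpa [Prod.map] using hf' _ h, hf p⟩
  slopes := by
    rintro p (rfl | ⟨t, rfl⟩)
    · exact ⟨hs.slope_ones, hs.slope_zeros⟩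
    · exact hs.slope_gap t
  finite := by
    refine ((hs.finite.image fun t => (gapLeft t, gapRight t)).insert (ones, zeros)).subset ?_
    intro p hp
    by_cases hA : Adj p
    · rcases hA with rfl | ⟨t, rfl⟩
      · exact Or.inl rfl
      · refine Or.inr ⟨t, fun ⟨r, hl, hr⟩ => hp ?_, rfl⟩
        rw [jump_eq (Or.inr ⟨t, rfl⟩) hl hr, div_self hl.1.ne']
    · exact absurd (if_neg hA) hp

lemma hasGapSlopes_of_slope_one {f : Cantor → Cantor} (h : ∀ a, HasSlope f a 1) :
    HasGapSlopes f :=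
  ⟨⟨1, h _⟩, ⟨1, h _⟩, fun _ => ⟨⟨1, h _⟩, 1, h _⟩, by
    simp [show ∀ t, ∃ r, HasSlope f (gapLeft t) r ∧ HasSlope f (gapRight t) r from
      fun t => ⟨1, h _, h _⟩]⟩

/-- `f` maps the gap `t` to a gap, with equal slopes at both ends. -/
def MapsGap (f : Cantor → Cantor) (t : List Bool) : Prop :=
  (∃ t', f (gapLeft t) = gapLeft t' ∧ f (gapRight t) = gapRight t') ∧
    ∃ r, HasSlope f (gapLeft t) r ∧ HasSlope f (gapRight t) r

lemma mapsGap_id (t : List Bool) : MapsGap id t :=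
  ⟨⟨t, rfl, rfl⟩, 1, hasSlope_id _, hasSlope_id _⟩

lemma MapsGap.cat {f g : Cantor → Cantor} {s t u : List Bool} (h : MapsGap g t)
    (hinj : Function.Injective g) (hfg : ∀ η, f (cat s η) = cat u (g η)) :
    MapsGap f (s ++ t) := by
  obtain ⟨⟨t', h₁, h₂⟩, r, hl, hr⟩ := h
  have eL : ∀ v w, gapLeft (v ++ w) = _root_.cat v (gapLeft w) := fun v w => cat_append v w _
  have eR : ∀ v w, gapRight (v ++ w) = _root_.cat v (gapRight w) := fun v w => cat_append v w _
  refine ⟨⟨u ++ t', by rw [eL, eL, hfg, h₁], by rw [eR, eR, hfg, h₂]⟩, r, ?_, ?_⟩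
  · rw [eL]; exact hl.cat hinj hfg
  · rw [eR]; exact hr.cat hinj hfg

lemma mapsGap_of_ends {f g k : Cantor → Cantor} {t t' s u v w : List Bool} {r : ℝ}
    (hg : ∀ η, f (cat s η) = cat u (g η)) (hk : ∀ η, f (cat v η) = cat w (k η))
    (ginj : Function.Injective g) (kinj : Function.Injective k)
    (hg₁ : g ones = ones) (hk₀ : k zeros = zeros)
    (sg : HasSlope g ones r) (sk : HasSlope k zeros r)
    (ht : gapLeft t = cat s ones ∧ gapRight t = cat v zeros)
    (ht' : gapLeft t' = cat u ones ∧ gapRight t' = cat w zeros) : MapsGap f t := by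
  refine ⟨⟨t', ?_, ?_⟩, r, ?_, ?_⟩
  · rw [ht.1, ht'.1, hg, hg₁]
  · rw [ht.2, ht'.2, hk, hk₀]
  · rw [ht.1]; exact sg.cat ginj hg
  · rw [ht.2]; exact sk.cat kinj hk

/-- `h` acts as `f` below the letter `b` and trivially below the other letter. -/
structure IsLetterExtension (b : Bool) (f h : Cantor → Cantor) : Prop where
  on : ∀ η, h (cat [b] η) = cat [b] (f η)
  off : ∀ η, h (cat [!b] η) = cat [!b] η

lemma IsLetterExtension.symm {b : Bool} {f h : Cantor ≃ₜ Cantor} (H : IsLetterExtension b f h) :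
    IsLetterExtension b f.symm h.symm where
  on η := by rw [h.symm_apply_eq, H.on, f.apply_symm_apply]
  off η := by rw [h.symm_apply_eq, H.off]

lemma IsLetterExtension.apply_zeros {b : Bool} {f h : Cantor → Cantor}
    (H : IsLetterExtension b f h) (hf : f zeros = zeros) (c : Bool) :
    h (cat [c] zeros) = cat [c] zeros := by
  rcases Bool.eq_or_eq_not c b with rfl | rfl
  · rw [H.on, hf]
  · rw [H.off]

lemma IsLetterExtension.apply_ones {b : Bool} {f h : Cantor → Cantor}
    (H : IsLetterExtension b f h) (hf : f ones = ones) (c : Bool) :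
    h (cat [c] ones) = cat [c] ones := by
  rcases Bool.eq_or_eq_not c b with rfl | rfl
  · rw [H.on, hf]
  · rw [H.off]

lemma PreservesGaps.letterExtension {b : Bool} {f h : Cantor → Cantor} (hf : PreservesGaps f)
    (H : IsLetterExtension b f h) : PreservesGaps h where
  map_zeros := by simpa [cat_false_zeros] using H.apply_zeros hf.map_zeros false
  map_ones := by simpa [cat_true_ones] using H.apply_ones hf.map_ones true
  map_gap t := by
    rcases t with _ | ⟨c, t⟩
    · exact ⟨[], by rw [gapLeft_nil, H.apply_ones hf.map_ones],
        by rw [gapRight_nil, H.apply_zeros hf.map_zeros]⟩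
    · rcases Bool.eq_or_eq_not c b with rfl | rfl
      · obtain ⟨t', h₁, h₂⟩ := hf.map_gap t
        exact ⟨c :: t', by rw [gapLeft_cons, gapLeft_cons, H.on, h₁],
          by rw [gapRight_cons, gapRight_cons, H.on, h₂]⟩
      · exact ⟨(!b) :: t, by rw [gapLeft_cons, H.off], by rw [gapRight_cons, H.off]⟩

lemma IsLetterExtension.hasSlope_on {b : Bool} {f h : Cantor → Cantor}
    (H : IsLetterExtension b f h) (hinj : Function.Injective f) {a : Cantor} {r : ℝ}
    (ha : HasSlope f a r) : HasSlope h (cat [b] a) r :=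
  ha.cat hinj H.on

lemma IsLetterExtension.hasSlope_off {b : Bool} {f h : Cantor → Cantor}
    (H : IsLetterExtension b f h) (a : Cantor) : HasSlope h (cat [!b] a) 1 :=
  hasSlope_of_cat H.off a

lemma IsLetterExtension.exists_hasSlope {b : Bool} {f h : Cantor → Cantor}
    (H : IsLetterExtension b f h) (hinj : Function.Injective f) {a : Cantor}
    (ha : ∃ r, HasSlope f a r) (c : Bool) : ∃ r, HasSlope h (cat [c] a) r := by
  obtain ⟨r, hr⟩ := ha
  rcases Bool.eq_or_eq_not c b with rfl | rfl
  · exact ⟨r, H.hasSlope_on hinj hr⟩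
  · exact ⟨1, H.hasSlope_off a⟩

lemma HasGapSlopes.letterExtension {b : Bool} {f h : Cantor → Cantor} (hf : HasGapSlopes f)
    (hinj : Function.Injective f) (H : IsLetterExtension b f h) : HasGapSlopes h where
  slope_zeros := by
    rw [← cat_false_zeros]
    exact H.exists_hasSlope hinj hf.slope_zeros false
  slope_ones := by
    rw [← cat_true_ones]
    exact H.exists_hasSlope hinj hf.slope_ones true
  slope_gap t := by
    rcases t with _ | ⟨c, t⟩
    · rw [gapLeft_nil, gapRight_nil]
      exact ⟨H.exists_hasSlope hinj hf.slope_ones _, H.exists_hasSlope hinj hf.slope_zeros _⟩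
    · rw [gapLeft_cons, gapRight_cons]
      exact ⟨H.exists_hasSlope hinj (hf.slope_gap t).1 c,
        H.exists_hasSlope hinj (hf.slope_gap t).2 c⟩
  finite := by
    refine ((hf.finite.image (List.cons b)).insert []).subset ?_
    intro t ht
    rcases t with _ | ⟨c, t⟩
    · exact Or.inl rfl
    · rcases Bool.eq_or_eq_not c b with rfl | rfl
      · refine Or.inr ⟨t, fun ⟨r, hl, hr⟩ => ht ⟨r, ?_, ?_⟩, rfl⟩
        · rw [gapLeft_cons]; exact H.hasSlope_on hinj hl
        · rw [gapRight_cons]; exact H.hasSlope_on hinj hr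
      · refine absurd ⟨1, ?_, ?_⟩ ht
        · rw [gapLeft_cons]; exact H.hasSlope_off _
        · rw [gapRight_cons]; exact H.hasSlope_off _

/-- `h` acts as `f` on the cone of `s` and trivially elsewhere. -/
structure IsConeExtension (s : List Bool) (f h : Cantor → Cantor) : Prop where
  on : ∀ η, h (cat s η) = cat s (f η)
  off : ∀ ξ, ¬ IsPrefixOf s ξ → h ξ = ξ

lemma IsConeExtension.eq_of_nil {f h : Cantor ≃ₜ Cantor} (H : IsConeExtension [] f h) :
    h = f := Homeomorph.ext fun ξ => by simpa using H.on ξ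

lemma IsConeExtension.symm {s : List Bool} {f h : Cantor ≃ₜ Cantor} (H : IsConeExtension s f h) :
    IsConeExtension s f.symm h.symm where
  on η := by rw [h.symm_apply_eq, H.on, f.apply_symm_apply]
  off ξ hξ := by rw [h.symm_apply_eq, H.off ξ hξ]

lemma isPrefixOf_cons_iff {b c : Bool} {s : List Bool} {η : Cantor} :
    IsPrefixOf (b :: s) (cat [c] η) ↔ b = c ∧ IsPrefixOf s η := by
  constructor
  · rintro ⟨ζ, h⟩
    rw [cat_cons_eq b s ζ, cat_singleton_inj] at h
    exact ⟨h.1.symm, ζ, h.2⟩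
  · rintro ⟨rfl, ζ, rfl⟩
    exact ⟨ζ, (cat_cons_eq b s ζ).symm⟩

lemma IsConeExtension.isLetterExtension {b : Bool} {s : List Bool} {f g h : Cantor → Cantor}
    (Hg : IsConeExtension s f g) (Hh : IsConeExtension (b :: s) f h) :
    IsLetterExtension b g h where
  on η := by
    by_cases hη : IsPrefixOf s η
    · obtain ⟨ζ, rfl⟩ := hη
      rw [← cat_cons_eq, Hh.on, Hg.on, ← cat_cons_eq]
    · rw [Hg.off η hη, Hh.off]
      simp [isPrefixOf_cons_iff, hη]
  off η := Hh.off _ (by simp [isPrefixOf_cons_iff])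

lemma isTame_of_isConeExtension {f : Cantor ≃ₜ Cantor} {F : List Bool → Cantor ≃ₜ Cantor}
    (hF : ∀ s, IsConeExtension s f (F s)) (hf : PreservesGaps f) (hf' : PreservesGaps f.symm)
    (hs : HasGapSlopes f) (s : List Bool) : IsTame (F s) := by
  suffices h : PreservesGaps (F s) ∧ PreservesGaps (F s).symm ∧ HasGapSlopes (F s) from
    .of_gaps (fun _ => h.1.adj) (fun _ => h.2.1.adj) h.2.2
  induction s with
  | nil => rw [(hF []).eq_of_nil]; exact ⟨hf, hf', hs⟩
  | cons b s ih =>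
    have H := (hF s).isLetterExtension (hF (b :: s))
    exact ⟨ih.1.letterExtension H, ih.2.1.letterExtension H.symm,
      ih.2.2.letterExtension (F s).injective H⟩

/-! ### The generators are tame -/

namespace LMData

variable (D : LMData)

lemma isConeExtension_xx (s : List Bool) : IsConeExtension s D.x (D.xx s) :=
  ⟨D.hxx s, D.hxx' s⟩

lemma isConeExtension_yy (s : List Bool) : IsConeExtension s D.y (D.yy s) :=
  ⟨D.hyy s, D.hyy' s⟩

lemma x_zero_zero (η : Cantor) : D.x (cat [false] (cat [false] η)) = cat [false] η := by
  simpa using D.hx00 η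

lemma x_zero_one (η : Cantor) :
    D.x (cat [false] (cat [true] η)) = cat [true] (cat [false] η) := by
  simpa using D.hx01 η

lemma x_one (η : Cantor) : D.x (cat [true] η) = cat [true] (cat [true] η) := by
  simpa using D.hx1 η

lemma x_symm_zero (η : Cantor) : D.x.symm (cat [false] η) = cat [false] (cat [false] η) := by
  rw [D.x.symm_apply_eq, x_zero_zero]

lemma x_symm_one_zero (η : Cantor) :
    D.x.symm (cat [true] (cat [false] η)) = cat [false] (cat [true] η) := by
  rw [D.x.symm_apply_eq, x_zero_one]

lemma x_symm_one_one (η : Cantor) : D.x.symm (cat [true] (cat [true] η)) = cat [true] η := by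
  rw [D.x.symm_apply_eq, x_one]

lemma x_zeros : D.x zeros = zeros := by
  have := D.x_zero_zero zeros
  rwa [cat_false_zeros, cat_false_zeros] at this

lemma x_ones : D.x ones = ones := by
  have := D.x_one ones
  rwa [cat_true_ones, cat_true_ones] at this

lemma y_zero_zero (η : Cantor) : D.y (cat [false] (cat [false] η)) = cat [false] (D.y η) := by
  simpa using D.hy00 η

lemma y_zero_one (η : Cantor) :
    D.y (cat [false] (cat [true] η)) = cat [true] (cat [false] (D.y.symm η)) := by
  simpa using D.hy01 η

lemma y_one (η : Cantor) : D.y (cat [true] η) = cat [true] (cat [true] (D.y η)) := by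
  simpa using D.hy1 η

lemma y_symm_zero (η : Cantor) :
    D.y.symm (cat [false] η) = cat [false] (cat [false] (D.y.symm η)) := by
  rw [D.y.symm_apply_eq, y_zero_zero, D.y.apply_symm_apply]

lemma y_symm_one_zero (η : Cantor) :
    D.y.symm (cat [true] (cat [false] η)) = cat [false] (cat [true] (D.y η)) := by
  rw [D.y.symm_apply_eq, y_zero_one, D.y.symm_apply_apply]

lemma y_symm_one_one (η : Cantor) :
    D.y.symm (cat [true] (cat [true] η)) = cat [true] (D.y.symm η) := by
  rw [D.y.symm_apply_eq, y_one, D.y.apply_symm_apply]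

lemma y_zeros : D.y zeros = zeros := by
  have := D.y_zero_zero zeros
  rw [cat_false_zeros, cat_false_zeros] at this
  exact eq_zeros this

lemma y_symm_zeros : D.y.symm zeros = zeros := by
  rw [D.y.symm_apply_eq, y_zeros]

lemma y_symm_ones : D.y.symm ones = ones := by
  have := D.y_symm_one_one ones
  rw [cat_true_ones, cat_true_ones] at this
  exact eq_ones this

lemma y_ones : D.y ones = ones := by
  rw [← D.y.eq_symm_apply, y_symm_ones]

lemma hasSlope_x (a : Cantor) : HasSlope D.x a 1 := by
  obtain ⟨b, a, rfl⟩ := exists_cat_singleton a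
  cases b
  · obtain ⟨b, a, rfl⟩ := exists_cat_singleton a
    cases b
    · simpa using hasSlope_of_cat D.hx00 a
    · simpa using hasSlope_of_cat D.hx01 a
  · exact hasSlope_of_cat D.hx1 a

lemma firstDiff_y_zeros (n : ℕ) : ∀ ξ, ξ ≠ zeros → firstDiff ξ zeros = n →
    firstDiff (D.y ξ) zeros = n / 2 := by
  induction n using Nat.strong_induction_on with
  | _ n ih =>
    intro ξ hξ hn
    obtain ⟨b, η, rfl⟩ := exists_cat_singleton ξ
    cases b with
    | true =>
      rw [firstDiff_eq_zero_of_ne (by simp [cat_singleton_zero, zeros])] at hn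
      subst hn
      rw [y_one, firstDiff_eq_zero_of_ne (by simp [cat_singleton_zero, zeros])]
    | false =>
      have hη : η ≠ zeros := fun h => hξ (by rw [h, cat_false_zeros])
      nth_rewrite 1 [← cat_false_zeros] at hn
      rw [firstDiff_cat_singleton _ hη] at hn
      obtain ⟨c, ζ, rfl⟩ := exists_cat_singleton η
      cases c with
      | true =>
        rw [firstDiff_eq_zero_of_ne (by simp [cat_singleton_zero, zeros])] at hn
        subst hn
        rw [y_zero_one, firstDiff_eq_zero_of_ne (by simp [cat_singleton_zero, zeros])]
      | false =>
        have hζ : ζ ≠ zeros := fun h => hη (by rw [h, cat_false_zeros])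
        nth_rewrite 1 [← cat_false_zeros] at hn
        rw [firstDiff_cat_singleton _ hζ] at hn
        have hy : D.y ζ ≠ zeros := fun h => hζ (D.y.injective (h.trans D.y_zeros.symm))
        rw [y_zero_zero]
        nth_rewrite 1 [← cat_false_zeros]
        rw [firstDiff_cat_singleton _ hy, ih _ (by omega) ζ hζ rfl]
        omega

lemma firstDiff_y_ones (n : ℕ) : ∀ ξ, ξ ≠ ones → firstDiff ξ ones = n →
    2 * n ≤ firstDiff (D.y ξ) ones ∧ firstDiff (D.y ξ) ones ≤ 2 * n + 1 := by
  induction n with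
  | zero =>
    intro ξ hξ hn
    obtain ⟨b, η, rfl⟩ := exists_cat_singleton ξ
    cases b with
    | true =>
      have hη : η ≠ ones := fun h => hξ (by rw [h, cat_true_ones])
      nth_rewrite 1 [← cat_true_ones] at hn
      rw [firstDiff_cat_singleton _ hη] at hn
      omega
    | false =>
      obtain ⟨c, ζ, rfl⟩ := exists_cat_singleton η
      cases c with
      | true =>
        rw [y_zero_one]
        nth_rewrite 1 2 [← cat_true_ones]
        rw [firstDiff_cat_singleton, firstDiff_eq_zero_of_ne]
        · simp
        · simp [cat_singleton_zero, ones]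
        · intro h
          have := congrFun h 0
          simp [cat_singleton_zero, ones] at this
      | false =>
        rw [y_zero_zero, firstDiff_eq_zero_of_ne (by simp [cat_singleton_zero, ones])]
        simp
  | succ n ih =>
    intro ξ hξ hn
    obtain ⟨b, η, rfl⟩ := exists_cat_singleton ξ
    cases b with
    | false =>
      rw [firstDiff_eq_zero_of_ne (by simp [cat_singleton_zero, ones])] at hn
      omega
    | true =>
      have hη : η ≠ ones := fun h => hξ (by rw [h, cat_true_ones])
      have hy : D.y η ≠ ones := fun h => hη (D.y.injective (h.trans D.y_ones.symm))
      nth_rewrite 1 [← cat_true_ones] at hn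
      rw [firstDiff_cat_singleton _ hη] at hn
      have key : firstDiff (cat [true] (cat [true] (D.y η))) ones =
          firstDiff (D.y η) ones + 2 := by
        have := firstDiff_cat [true, true] hy
        simpa [cat_true_ones] using this
      rw [y_one, key]
      have := ih η hη (by omega)
      omega

lemma hasSlope_y_zeros : HasSlope D.y zeros (1 / 2) := by
  refine hasSlope_of_bound (by norm_num) fun ξ hξ => ?_
  rw [D.y_zeros, D.firstDiff_y_zeros _ ξ hξ rfl, abs_le]
  have h₁ : 2 * (firstDiff ξ zeros / 2) ≤ firstDiff ξ zeros := by omega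
  have h₂ : firstDiff ξ zeros ≤ 2 * (firstDiff ξ zeros / 2) + 1 := by omega
  generalize firstDiff ξ zeros / 2 = k at *
  rify at h₁ h₂
  constructor <;> linarith

lemma hasSlope_y_ones : HasSlope D.y ones 2 := by
  refine hasSlope_of_bound (by norm_num) fun ξ hξ => ?_
  obtain ⟨h₁, h₂⟩ := D.firstDiff_y_ones _ ξ hξ rfl
  rw [D.y_ones, abs_le]
  rify at h₁ h₂
  constructor <;> linarith

lemma hasSlope_y_symm_zeros : HasSlope D.y.symm zeros 2 := by
  simpa [y_zeros] using D.hasSlope_y_zeros.symm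

lemma hasSlope_y_symm_ones : HasSlope D.y.symm ones (1 / 2) := by
  simpa [y_ones] using D.hasSlope_y_ones.symm

lemma gap_nil_ends_one :
    gapLeft [] = cat [false, true] ones ∧ gapRight [] = cat [true] zeros := by
  simp [gapLeft_nil, gapRight_nil, cat_true_ones]

lemma gap_nil_ends_zero :
    gapLeft [] = cat [false] ones ∧ gapRight [] = cat [true, false] zeros := by
  simp [gapLeft_nil, gapRight_nil, cat_false_zeros]

lemma gap_zero_ends :
    gapLeft [false] = cat [false, false] ones ∧ gapRight [false] = cat [false, true] zeros := by
  simp [gapLeft_cons, gapRight_cons, gapLeft_nil, gapRight_nil]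

lemma gap_one_ends :
    gapLeft [true] = cat [true, false] ones ∧ gapRight [true] = cat [true, true] zeros := by
  simp [gapLeft_cons, gapRight_cons, gapLeft_nil, gapRight_nil]

lemma mapsGap_x (t : List Bool) : MapsGap D.x t := by
  rcases t with _ | ⟨_ | _, _ | ⟨_ | _, t⟩⟩
  · exact mapsGap_of_ends D.hx01 D.hx1 Function.injective_id Function.injective_id rfl rfl
      (hasSlope_id _) (hasSlope_id _) gap_nil_ends_one gap_one_ends
  · exact mapsGap_of_ends D.hx00 D.hx01 Function.injective_id Function.injective_id rfl rfl
      (hasSlope_id _) (hasSlope_id _) gap_zero_ends gap_nil_ends_zero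
  · exact (mapsGap_id t).cat Function.injective_id D.hx00
  · exact (mapsGap_id t).cat Function.injective_id D.hx01
  · exact (mapsGap_id []).cat Function.injective_id D.hx1
  · exact (mapsGap_id (false :: t)).cat Function.injective_id D.hx1
  · exact (mapsGap_id (true :: t)).cat Function.injective_id D.hx1

lemma mapsGap_x_symm (t : List Bool) : MapsGap D.x.symm t := by
  have h0 : ∀ η, D.x.symm (cat [false] η) = cat [false, false] η := by simp [x_symm_zero]
  have h10 : ∀ η, D.x.symm (cat [true, false] η) = cat [false, true] η := by
    simp [x_symm_one_zero]
  have h11 : ∀ η, D.x.symm (cat [true, true] η) = cat [true] η := by simp [x_symm_one_one]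
  rcases t with _ | ⟨_ | _, t⟩
  · exact mapsGap_of_ends h0 h10 Function.injective_id Function.injective_id rfl rfl
      (hasSlope_id _) (hasSlope_id _) gap_nil_ends_zero gap_zero_ends
  · exact (mapsGap_id t).cat Function.injective_id h0
  · rcases t with _ | ⟨_ | _, t⟩
    · exact mapsGap_of_ends h10 h11 Function.injective_id Function.injective_id rfl rfl
        (hasSlope_id _) (hasSlope_id _) gap_one_ends gap_nil_ends_one
    · exact (mapsGap_id t).cat Function.injective_id h10
    · exact (mapsGap_id t).cat Function.injective_id h11

lemma mapsGap_y_and_symm (n : ℕ) : ∀ t : List Bool, t.length = n →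
    MapsGap D.y t ∧ MapsGap D.y.symm t := by
  have h0 : ∀ η, D.y.symm (cat [false] η) = cat [false, false] (D.y.symm η) := by
    simp [y_symm_zero]
  have h10 : ∀ η, D.y.symm (cat [true, false] η) = cat [false, true] (D.y η) := by
    simp [y_symm_one_zero]
  have h11 : ∀ η, D.y.symm (cat [true, true] η) = cat [true] (D.y.symm η) := by
    simp [y_symm_one_one]
  have hi := D.y.injective
  have hi' := D.y.symm.injective
  induction n using Nat.strong_induction_on with
  | _ n ih =>
    intro t ht
    subst ht
    constructor
    · rcases t with _ | ⟨_ | _, t⟩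
      · exact mapsGap_of_ends D.hy01 D.hy1 hi' hi D.y_symm_ones D.y_zeros
          D.hasSlope_y_symm_ones D.hasSlope_y_zeros gap_nil_ends_one gap_one_ends
      · rcases t with _ | ⟨_ | _, t⟩
        · exact mapsGap_of_ends D.hy00 D.hy01 hi hi' D.y_ones D.y_symm_zeros
            D.hasSlope_y_ones D.hasSlope_y_symm_zeros gap_zero_ends gap_nil_ends_zero
        · exact (ih t.length (by simp) t rfl).1.cat hi D.hy00
        · exact (ih t.length (by simp) t rfl).2.cat hi' D.hy01
      · exact (ih t.length (by simp) t rfl).1.cat hi D.hy1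
    · rcases t with _ | ⟨_ | _, t⟩
      · exact mapsGap_of_ends h0 h10 hi' hi D.y_symm_ones D.y_zeros
          D.hasSlope_y_symm_ones D.hasSlope_y_zeros gap_nil_ends_zero gap_zero_ends
      · exact (ih t.length (by simp) t rfl).2.cat hi' h0
      · rcases t with _ | ⟨_ | _, t⟩
        · exact mapsGap_of_ends h10 h11 hi hi' D.y_ones D.y_symm_zeros
            D.hasSlope_y_ones D.hasSlope_y_symm_zeros gap_one_ends gap_nil_ends_one
        · exact (ih t.length (by simp) t rfl).1.cat hi h10
        · exact (ih t.length (by simp) t rfl).2.cat hi' h11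

lemma isTame_xx (s : List Bool) : IsTame (D.xx s) :=
  isTame_of_isConeExtension D.isConeExtension_xx
    ⟨D.x_zeros, D.x_ones, fun t => (D.mapsGap_x t).1⟩
    ⟨by rw [D.x.symm_apply_eq, x_zeros], by rw [D.x.symm_apply_eq, x_ones],
      fun t => (D.mapsGap_x_symm t).1⟩
    (hasGapSlopes_of_slope_one D.hasSlope_x) s

lemma mapsGap_y (t : List Bool) : MapsGap D.y t := (D.mapsGap_y_and_symm _ t rfl).1

lemma hasGapSlopes_y : HasGapSlopes D.y where
  slope_zeros := ⟨_, D.hasSlope_y_zeros⟩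
  slope_ones := ⟨_, D.hasSlope_y_ones⟩
  slope_gap t := by
    obtain ⟨r, hl, hr⟩ := (D.mapsGap_y t).2
    exact ⟨⟨r, hl⟩, r, hr⟩
  finite := by simp [fun t => (D.mapsGap_y t).2]

lemma isTame_yy (s : List Bool) : IsTame (D.yy s) :=
  isTame_of_isConeExtension D.isConeExtension_yy
    ⟨D.y_zeros, D.y_ones, fun t => (D.mapsGap_y t).1⟩
    ⟨D.y_symm_zeros, D.y_symm_ones, fun t => (D.mapsGap_y_and_symm _ t rfl).2.1⟩
    D.hasGapSlopes_y s

lemma finprod_jump_yy_nil : ∏ᶠ p, jump (D.yy []) p = 4 := by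
  rw [(D.isConeExtension_yy []).eq_of_nil, finprod_eq_single _ (ones, zeros),
    jump_eq (Or.inl rfl) D.hasSlope_y_ones D.hasSlope_y_zeros]
  · norm_num
  · intro p hp
    by_cases hA : Adj p
    · rcases hA with rfl | ⟨t, rfl⟩
      · exact absurd rfl hp
      · obtain ⟨r, hl, hr⟩ := (D.mapsGap_y t).2
        rw [jump_eq (Or.inr ⟨t, rfl⟩) hl hr, div_self hl.1.ne']
    · exact if_neg hA

lemma p_zero_apply (b : Bool) (η : Cantor) : D.p 0 (cat [b] η) = cat [!b] η := by
  cases b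
  · simpa using D.hp2 0 η
  · simpa using D.hp3 0 η

lemma p_zero_symm : (D.p 0).symm = D.p 0 := by
  ext1 ξ
  obtain ⟨b, η, rfl⟩ := exists_cat_singleton ξ
  rw [(D.p 0).symm_apply_eq, p_zero_apply, p_zero_apply, Bool.not_not]

lemma adj_p_zero {p : Cantor × Cantor} (hp : Adj p) : Adj (Prod.map (D.p 0) (D.p 0) p) := by
  rcases hp with rfl | ⟨_ | ⟨b, t⟩, rfl⟩
  · refine Or.inr ⟨[], ?_⟩
    rw [← cat_true_ones, ← cat_false_zeros]
    simp [p_zero_apply, gapLeft_nil, gapRight_nil]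
  · refine Or.inl ?_
    simp [p_zero_apply, gapLeft_nil, gapRight_nil, cat_true_ones, cat_false_zeros]
  · refine Or.inr ⟨(!b) :: t, ?_⟩
    simp [p_zero_apply, gapLeft_cons, gapRight_cons]

lemma isTame_p_zero : IsTame (D.p 0) := by
  refine .of_gaps (fun _ => D.adj_p_zero) (fun _ => ?_) (hasGapSlopes_of_slope_one fun a => ?_)
  · rw [p_zero_symm]; exact D.adj_p_zero
  · obtain ⟨b, a, rfl⟩ := exists_cat_singleton a
    exact hasSlope_of_cat (D.p_zero_apply b) a

/-! ### Relations between the generators -/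

lemma exists_prefix_ones (n : ℕ) (ξ : Cantor) :
    (∃ k < n, ∃ η, ξ = cat (List.replicate k true ++ [false]) η) ∨
      ∃ η, ξ = cat (List.replicate n true) η := by
  induction n generalizing ξ with
  | zero => exact Or.inr ⟨ξ, by simp⟩
  | succ n ih =>
    obtain ⟨b, η, rfl⟩ := exists_cat_singleton ξ
    cases b with
    | false => exact Or.inl ⟨0, by omega, η, by simp⟩
    | true =>
      rcases ih η with ⟨k, hk, ζ, rfl⟩ | ⟨ζ, rfl⟩
      · exact Or.inl ⟨k + 1, by omega, ζ, by
          rw [List.replicate_succ, List.cons_append, ← cat_cons_eq]⟩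
      · exact Or.inr ⟨ζ, by rw [List.replicate_succ, ← cat_cons_eq]⟩

lemma not_isPrefixOf_replicate {k n : ℕ} (hk : k < n) (η : Cantor) :
    ¬ IsPrefixOf (List.replicate n true) (cat (List.replicate k true ++ [false]) η) := by
  induction k generalizing n with
  | zero =>
    obtain ⟨n, rfl⟩ := Nat.exists_eq_succ_of_ne_zero hk.ne'
    simp [List.replicate_succ, isPrefixOf_cons_iff]
  | succ k ih =>
    obtain ⟨n, rfl⟩ := Nat.exists_eq_succ_of_ne_zero (Nat.ne_zero_of_lt hk)
    rw [Nat.succ_eq_add_one, List.replicate_succ, List.replicate_succ, List.cons_append,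
      cat_cons_eq true (_ ++ _) η, isPrefixOf_cons_iff]
    exact fun h => ih (by omega) h.2

lemma p_eq_mul (n : ℕ) : D.p n = D.p (n + 1) * D.xx (List.replicate n true) := by
  ext1 ξ
  rw [homeo_mul_apply]
  rcases exists_prefix_ones n ξ with ⟨k, hk, η, rfl⟩ | ⟨η, rfl⟩
  · rw [D.hxx' _ _ (not_isPrefixOf_replicate hk η), D.hp1 _ _ _ hk, D.hp1 _ _ _ (by omega)]
  · rw [D.hxx]
    obtain ⟨b, η, rfl⟩ := exists_cat_singleton η
    cases b
    · obtain ⟨b, η, rfl⟩ := exists_cat_singleton η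
      cases b
      · rw [x_zero_zero, ← cat_append _ [false] (cat [false] η), D.hp2, ← cat_append,
          ← cat_append, D.hp1 (n + 1) n η (by omega)]
      · rw [x_zero_one, ← cat_append _ [false], D.hp2, ← cat_append,
          ← cat_append _ [true] (cat [false] η), ← List.replicate_succ', ← List.replicate_succ',
          ← cat_append, D.hp2]
    · rw [x_one, ← cat_append, ← cat_append, ← cat_append, ← List.replicate_succ',
        ← List.replicate_succ', D.hp3, D.hp3]

lemma x_mul_p_zero : D.xx [] * D.p 0 = D.p 1 * D.p 1 := by
  have h0 : ∀ η, D.p 1 (cat [false] η) = cat [true] (cat [false] η) := fun η => by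
    simpa using D.hp1 1 0 η one_pos
  have h10 : ∀ η, D.p 1 (cat [true] (cat [false] η)) = cat [true] (cat [true] η) := fun η => by
    simpa [List.replicate_succ] using D.hp2 1 η
  have h11 : ∀ η, D.p 1 (cat [true] (cat [true] η)) = cat [false] η := fun η => by
    simpa [List.replicate_succ] using D.hp3 1 η
  rw [(D.isConeExtension_xx []).eq_of_nil]
  ext1 ξ
  obtain ⟨b, η, rfl⟩ := exists_cat_singleton ξ
  cases b
  · simp [p_zero_apply, x_one, h0, h10]
  · obtain ⟨b, η, rfl⟩ := exists_cat_singleton η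
    cases b
    · simp [p_zero_apply, x_zero_zero, h11, h10]
    · simp [p_zero_apply, x_zero_one, h11, h0]

lemma yy_nil_eq :
    D.yy [] = D.yy [true, true] * (D.yy [true, false])⁻¹ * D.yy [false] * D.xx [] := by
  rw [(D.isConeExtension_xx []).eq_of_nil, (D.isConeExtension_yy []).eq_of_nil]
  have on₁₁ : ∀ η, D.yy [true, true] (cat [true] (cat [true] η)) =
      cat [true] (cat [true] (D.y η)) := fun η => by simpa using D.hyy [true, true] η
  have on₁₀ : ∀ η, (D.yy [true, false]).symm (cat [true] (cat [false] η)) =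
      cat [true] (cat [false] (D.y.symm η)) := fun η => by
    simpa using (D.isConeExtension_yy [true, false]).symm.on η
  have off : ∀ b s ξ, ¬ (b = true ∧ IsPrefixOf s ξ) →
      D.yy (true :: s) (cat [b] ξ) = cat [b] ξ := fun b s ξ h =>
    D.hyy' _ _ fun h' => h (by simpa [eq_comm] using isPrefixOf_cons_iff.1 h')
  have off' : ∀ b s ξ, ¬ (b = true ∧ IsPrefixOf s ξ) →
      (D.yy (true :: s)).symm (cat [b] ξ) = cat [b] ξ := fun b s ξ h => by
    rw [Homeomorph.symm_apply_eq, off b s ξ h]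
  have off₀ : ∀ η, D.yy [false] (cat [true] η) = cat [true] η := fun η =>
    D.hyy' _ _ (by simp [isPrefixOf_cons_iff])
  ext1 ξ
  simp only [homeo_mul_apply, homeo_inv_apply]
  obtain ⟨b, η, rfl⟩ := exists_cat_singleton ξ
  cases b
  · obtain ⟨b, η, rfl⟩ := exists_cat_singleton η
    cases b
    · rw [x_zero_zero, D.hyy, off' _ _ _ (by simp), off _ _ _ (by simp), y_zero_zero]
    · rw [x_zero_one, off₀, on₁₀, off _ _ _ (by simp [isPrefixOf_cons_iff]), y_zero_one]
  · rw [x_one, off₀, off' _ _ _ (by simp [isPrefixOf_cons_iff]), on₁₁, y_one]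

lemma not_isPrefixOf_append_singleton (s : List Bool) {b c : Bool} (h : b ≠ c) (η : Cantor) :
    ¬ IsPrefixOf (s ++ [b]) (cat s (cat [c] η)) := by
  rintro ⟨ζ, hζ⟩
  rw [cat_append] at hζ
  exact h (cat_singleton_inj.1 (cat_injective s hζ)).1.symm

lemma xx_pentagon (s : List Bool) :
    D.xx s * D.xx s = D.xx (s ++ [true]) * D.xx s * D.xx (s ++ [false]) := by
  have on : ∀ b η, D.xx (s ++ [b]) (cat s (cat [b] η)) = cat s (cat [b] (D.x η)) := by
    intro b η
    rw [← cat_append, D.hxx, cat_append]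
  have off₁ : ∀ η, D.xx (s ++ [true]) (cat s (cat [false] η)) = cat s (cat [false] η) := fun η =>
    D.hxx' _ _ (not_isPrefixOf_append_singleton s (by simp) η)
  have off₀ : ∀ η, D.xx (s ++ [false]) (cat s (cat [true] η)) = cat s (cat [true] η) := fun η =>
    D.hxx' _ _ (not_isPrefixOf_append_singleton s (by simp) η)
  ext1 ξ
  simp only [homeo_mul_apply]
  by_cases hξ : IsPrefixOf s ξ
  · obtain ⟨η, rfl⟩ := hξ
    obtain ⟨b, η, rfl⟩ := exists_cat_singleton η
    cases b
    · obtain ⟨b, η, rfl⟩ := exists_cat_singleton η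
      cases b
      · obtain ⟨b, η, rfl⟩ := exists_cat_singleton η
        cases b <;> simp [on, off₁, D.hxx, x_zero_zero, x_zero_one]
      · simp [on, D.hxx, x_zero_one, x_one]
    · simp [on, off₀, D.hxx, x_one]
  · have : ∀ b, ¬ IsPrefixOf (s ++ [b]) ξ := fun b ⟨η, h⟩ => hξ ⟨cat [b] η, by
      rw [h, cat_append]⟩
    rw [D.hxx' _ _ hξ, D.hxx' _ _ hξ, D.hxx' _ _ (this false), D.hxx' _ _ hξ,
      D.hxx' _ _ (this true)]

end LMData

lemma IsConeExtension.conj {f h k g : Cantor ≃ₜ Cantor} {s t : List Bool}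
    (Hh : IsConeExtension s f h) (Hk : IsConeExtension t f k)
    (hg : ∀ η, g (cat s η) = cat t η) : g * h = k * g := by
  ext1 ξ
  simp only [homeo_mul_apply]
  by_cases hξ : IsPrefixOf s ξ
  · obtain ⟨η, rfl⟩ := hξ
    rw [Hh.on, hg, hg, Hk.on]
  · rw [Hh.off ξ hξ, Hk.off]
    rintro ⟨η, h'⟩
    exact hξ ⟨η, g.injective (h'.trans (hg η).symm)⟩

namespace LMData

variable (D : LMData)

lemma xx_mem (s : List Bool) : D.xx s ∈ Shat D :=
  Subgroup.subset_closure (Or.inl (Or.inl ⟨s, rfl⟩))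

lemma yy_mem (s : List Bool) : D.yy s ∈ Shat D :=
  Subgroup.subset_closure (Or.inl (Or.inr ⟨s, rfl⟩))

lemma p_mem (n : ℕ) : D.p n ∈ Shat D := Subgroup.subset_closure (Or.inr ⟨n, rfl⟩)

variable {D} {A : Type*} [CommGroup A] (θ : Shat D →* A)

lemma map_eq_of_conj {f : Cantor ≃ₜ Cantor} {F : List Bool → Cantor ≃ₜ Cantor}
    (hF : ∀ s, IsConeExtension s f (F s)) (hm : ∀ s, F s ∈ Shat D) {g : Cantor ≃ₜ Cantor}
    (hgm : g ∈ Shat D) {s t : List Bool} (hg : ∀ η, g (cat s η) = cat t η) :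
    θ ⟨F s, hm s⟩ = θ ⟨F t, hm t⟩ := by
  have h : (⟨g, hgm⟩ : Shat D) * ⟨F s, hm s⟩ = ⟨F t, hm t⟩ * ⟨g, hgm⟩ :=
    Subtype.ext ((hF s).conj (hF t) hg)
  have h' := congrArg θ h
  rw [map_mul, map_mul, mul_comm] at h'
  exact mul_right_cancel h'

lemma map_eq_map_zero {f : Cantor ≃ₜ Cantor} {F : List Bool → Cantor ≃ₜ Cantor}
    (hF : ∀ s, IsConeExtension s f (F s)) (hm : ∀ s, F s ∈ Shat D) (n : ℕ) :
    ∀ s : List Bool, s.length = n + 1 → θ ⟨F s, hm s⟩ = θ ⟨F [false], hm [false]⟩ := by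
  have hswap : ∀ b s, θ ⟨F (b :: s), hm _⟩ = θ ⟨F ((!b) :: s), hm _⟩ := fun b s =>
    map_eq_of_conj θ hF hm (D.p_mem 0) fun η => by
      rw [cat_cons_eq b s η, cat_cons_eq (!b) s η, p_zero_apply]
  have hx : D.x ∈ Shat D := (D.isConeExtension_xx []).eq_of_nil ▸ D.xx_mem []
  induction n with
  | zero =>
    intro s hs
    obtain ⟨b, rfl⟩ := List.length_eq_one_iff.1 hs
    cases b
    · rfl
    · exact hswap true []
  | succ n ih =>
    have h00 : ∀ s : List Bool, s.length = n →
        θ ⟨F (false :: false :: s), hm _⟩ = θ ⟨F [false], hm [false]⟩ := fun s hs =>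
      (map_eq_of_conj θ hF hm hx fun η => by
        rw [cat_cons, cat_cons_eq false s η, x_zero_zero, ← cat_cons_eq]).trans
      (ih (false :: s) (by simp [hs]))
    have h10 : ∀ s : List Bool, s.length = n →
        θ ⟨F (true :: false :: s), hm _⟩ = θ ⟨F [false], hm [false]⟩ := fun s hs =>
      (hswap _ _).trans (h00 s hs)
    have h01 : ∀ s : List Bool, s.length = n →
        θ ⟨F (false :: true :: s), hm _⟩ = θ ⟨F [false], hm [false]⟩ := fun s hs =>
      (map_eq_of_conj θ hF hm hx fun η => by
        rw [cat_cons, cat_cons_eq true s η, x_zero_one, cat_cons, cat_cons_eq false s η]).trans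
      (h10 s hs)
    intro s hs
    rcases s with _ | ⟨_ | _, _ | ⟨_ | _, s⟩⟩ <;> simp at hs
    · exact h00 s hs
    · exact h01 s hs
    · exact h10 s hs
    · exact (hswap _ _).trans (h01 s hs)

lemma map_xx (s : List Bool) : θ ⟨D.xx s, D.xx_mem s⟩ = 1 := by
  have hne : ∀ s : List Bool, s ≠ [] →
      θ ⟨D.xx s, D.xx_mem s⟩ = θ ⟨D.xx [false], D.xx_mem [false]⟩ := fun s hs =>
    map_eq_map_zero θ D.isConeExtension_xx D.xx_mem (s.length - 1) s (by
      have := List.length_pos_iff.2 hs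
      omega)
  have hpent : ∀ s, θ ⟨D.xx s, D.xx_mem s⟩ =
      θ ⟨D.xx [false], D.xx_mem [false]⟩ * θ ⟨D.xx [false], D.xx_mem [false]⟩ := by
    intro s
    have h : (⟨D.xx s, D.xx_mem s⟩ : Shat D) * ⟨D.xx s, D.xx_mem s⟩ =
        ⟨D.xx (s ++ [true]), D.xx_mem _⟩ * ⟨D.xx s, D.xx_mem s⟩ *
          ⟨D.xx (s ++ [false]), D.xx_mem _⟩ := Subtype.ext (D.xx_pentagon s)
    have h' := congrArg θ h
    rw [map_mul, map_mul, map_mul, hne (s ++ [true]) (by simp), hne (s ++ [false]) (by simp),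
      mul_right_comm] at h'
    exact mul_right_cancel h'
  have h0 : θ ⟨D.xx [false], D.xx_mem [false]⟩ = 1 := by
    have := hpent [false]
    exact (mul_eq_left.1 this.symm)
  rw [hpent, h0, one_mul]

lemma map_p (n : ℕ) : θ ⟨D.p n, D.p_mem n⟩ = 1 := by
  have hstep : ∀ n, θ ⟨D.p n, D.p_mem n⟩ = θ ⟨D.p (n + 1), D.p_mem (n + 1)⟩ := by
    intro n
    have h : (⟨D.p n, D.p_mem n⟩ : Shat D) =
        ⟨D.p (n + 1), D.p_mem _⟩ * ⟨D.xx (List.replicate n true), D.xx_mem _⟩ :=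
      Subtype.ext (D.p_eq_mul n)
    rw [h, map_mul, map_xx, mul_one]
  induction n with
  | zero =>
    have h : (⟨D.xx [], D.xx_mem []⟩ : Shat D) * ⟨D.p 0, D.p_mem 0⟩ =
        ⟨D.p 1, D.p_mem 1⟩ * ⟨D.p 1, D.p_mem 1⟩ := Subtype.ext D.x_mul_p_zero
    have h' := congrArg θ h
    rw [map_mul, map_mul, map_xx, one_mul, ← hstep 0] at h'
    exact mul_eq_left.1 h'.symm
  | succ n ih => rw [← hstep n, ih]

lemma map_yy (s : List Bool) : θ ⟨D.yy s, D.yy_mem s⟩ = θ ⟨D.yy [], D.yy_mem []⟩ := by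
  have hne : ∀ s : List Bool, s ≠ [] →
      θ ⟨D.yy s, D.yy_mem s⟩ = θ ⟨D.yy [false], D.yy_mem [false]⟩ := fun s hs =>
    map_eq_map_zero θ D.isConeExtension_yy D.yy_mem (s.length - 1) s (by
      have := List.length_pos_iff.2 hs
      omega)
  have hnil : θ ⟨D.yy [], D.yy_mem []⟩ = θ ⟨D.yy [false], D.yy_mem [false]⟩ := by
    have h : (⟨D.yy [], D.yy_mem []⟩ : Shat D) =
        ⟨D.yy [true, true], D.yy_mem _⟩ * (⟨D.yy [true, false], D.yy_mem _⟩)⁻¹ *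
          ⟨D.yy [false], D.yy_mem _⟩ * ⟨D.xx [], D.xx_mem []⟩ := Subtype.ext D.yy_nil_eq
    rw [h, map_mul, map_mul, map_mul, map_inv, map_xx, hne [true, true] (by simp),
      hne [true, false] (by simp)]
    simp
  rcases eq_or_ne s [] with rfl | hs
  · rfl
  · rw [hne s hs, hnil]

variable (D)

lemma Shat_le_tame : Shat D ≤ tameSubgroup := by
  refine (Subgroup.closure_le _).2 ?_
  rintro f ((⟨s, rfl⟩ | ⟨s, rfl⟩) | ⟨n, rfl⟩)
  · exact D.isTame_xx s
  · exact D.isTame_yy s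
  · change D.p n ∈ tameSubgroup
    induction n with
    | zero => exact D.isTame_p_zero
    | succ n ih =>
      have hx : D.xx (List.replicate n true) ∈ tameSubgroup := D.isTame_xx _
      rw [D.p_eq_mul n] at ih
      exact (Subgroup.mul_mem_cancel_right _ hx).1 ih

/-- The total jump as a homomorphism on the abelianization. -/
noncomputable def abelianizedJump : Abelianization (Shat D) →* ℝˣ :=
  Abelianization.lift (totalJump.comp (Subgroup.inclusion D.Shat_le_tame)).toHomUnits

lemma abelianizedJump_yy_nil :
    (D.abelianizedJump (Abelianization.of ⟨D.yy [], D.yy_mem []⟩) : ℝ) = 4 := by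
  rw [abelianizedJump, Abelianization.lift_apply_of]
  exact D.finprod_jump_yy_nil

lemma zpowersHom_bijective : Function.Bijective
    (zpowersHom _ (Abelianization.of (⟨D.yy [], D.yy_mem []⟩ : Shat D))) := by
  constructor
  · rw [injective_iff_map_eq_one]
    intro n hn
    have h := congrArg (fun a => ((D.abelianizedJump a : ℝˣ) : ℝ)) hn
    simp only [zpowersHom_apply, map_zpow, Units.val_zpow_eq_zpow_val, abelianizedJump_yy_nil,
      map_one, Units.val_one] at h
    exact (zpow_eq_one_iff_right₀ (by norm_num) (by norm_num)).1 h
  · rw [← MonoidHom.range_eq_top, eq_top_iff]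
    rintro a -
    obtain ⟨⟨f, hf⟩, rfl⟩ := QuotientGroup.mk_surjective a
    change Abelianization.of _ ∈ _
    induction hf using Subgroup.closure_induction with
    | mem f h =>
      rcases h with (⟨s, rfl⟩ | ⟨s, rfl⟩) | ⟨n, rfl⟩
      · rw [map_xx]; exact one_mem _
      · rw [map_yy _ s]; exact ⟨Multiplicative.ofAdd 1, by simp⟩
      · rw [map_p]; exact one_mem _
    | one => exact one_mem _
    | mul f g hf hg ihf ihg => exact mul_mem ihf ihg
    | inv f hf ih => exact inv_mem ih

end LMData

/-- the abelianization of `Ŝ` is isomorphic to `ℤ`, via an isomorphism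
sending (the class of) each `y_s` to `1`. -/
theorem statement3 (D : LMData) :
    ∃ e : Abelianization ↥(Shat D) ≃* Multiplicative ℤ,
      ∀ (s : List Bool) (h : D.yy s ∈ Shat D),
        e (Abelianization.of ⟨D.yy s, h⟩) = Multiplicative.ofAdd 1 := by
  let e := MulEquiv.ofBijective _ D.zpowersHom_bijective
  refine ⟨e.symm, fun s h => ?_⟩
  rw [LMData.map_yy, e.symm_apply_eq]
  simp [e]
end
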